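/- arXiv:2107.04176 — 8 statements merged into one kernel-verified Lean document; each statement's English description precedes it below -/
import Mathlib

section
/- For every s₀ > 0 and every integer k ≥ 2 with 1/k² < s₀, there exists a differentiable function ṽ_k : [1/k², s₀) → ℝ with ṽ_k(1/k²) = 1/k, ṽ_k(s) > 0 for all s ∈ (1/k², s₀), ṽ_k'(s) = s/ṽ_k(s) − 1/√(2s) on (1/k², s₀), and ṽ_k(s) ≤ max{1/k, √2 · s^{3/2}} for all s ∈ (1/k², s₀). -/
open Set in
/-- A globally bounded, globally Lipschitz scalar field has a solution on the whole interval. -/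
theorem exists_hasDerivWithinAt_Icc_of_lipschitz_of_bounded {F : ℝ → ℝ → ℝ} {a b y : ℝ}
    {K L : NNReal} (hab : a ≤ b) (hLip : ∀ t ∈ Icc a b, LipschitzWith K (F t))
    (hcont : ∀ x, ContinuousOn (fun t => F t x) (Icc a b))
    (hbound : ∀ t ∈ Icc a b, ∀ x, ‖F t x‖ ≤ L) :
    ∃ v : ℝ → ℝ, v a = y ∧ ∀ t ∈ Icc a b, HasDerivWithinAt v (F t (v t)) (Icc a b) t := by
  have hPL : IsPicardLindelof F (⟨a, left_mem_Icc.2 hab⟩ : Icc a b) y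
      (L * (b - a).toNNReal) 0 L K := by
    refine ⟨fun t ht => (hLip t ht).lipschitzOnWith, fun x _ => hcont x,
      fun t ht x _ => hbound t ht x, ?_⟩
    simp [sub_nonneg.2 hab]
  exact hPL.exists_eq_forall_mem_Icc_hasDerivWithinAt₀

/-- The nullcline `v = s * √(2 * s)` separates decreasing from increasing solutions. -/
theorem div_lt_one_div_sqrt_iff {s v : ℝ} (hs : 0 < s) (hv : 0 < v) :
    s / v < 1 / Real.sqrt (2 * s) ↔ s * Real.sqrt (2 * s) < v := by
  have h : 0 < Real.sqrt (2 * s) := Real.sqrt_pos.2 (by linarith)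
  rw [div_lt_div_iff₀ hv h, one_mul]

theorem one_div_sqrt_lt_div_iff {s v : ℝ} (hs : 0 < s) (hv : 0 < v) :
    1 / Real.sqrt (2 * s) < s / v ↔ v < s * Real.sqrt (2 * s) := by
  have h : 0 < Real.sqrt (2 * s) := Real.sqrt_pos.2 (by linarith)
  rw [div_lt_div_iff₀ h hv, one_mul]

theorem mul_sqrt_two_mul_lt {s t : ℝ} (hs : 0 < s) (hst : s < t) :
    s * Real.sqrt (2 * s) < t * Real.sqrt (2 * t) := by
  have h : Real.sqrt (2 * s) < Real.sqrt (2 * t) :=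
    Real.sqrt_lt_sqrt (by linarith) (by linarith)
  have h0 : 0 ≤ Real.sqrt (2 * s) := Real.sqrt_nonneg _
  nlinarith

theorem lipschitzWith_div_max {s b m : ℝ} (hs : 0 ≤ s) (hsb : s ≤ b) (hm : 0 < m) :
    LipschitzWith (b / m ^ 2).toNNReal (fun x => s / max x m) := by
  refine LipschitzWith.of_dist_le_mul fun x y => ?_
  have hx : m ≤ max x m := le_max_right _ _
  have hy : m ≤ max y m := le_max_right _ _
  have hx0 : 0 < max x m := hm.trans_le hx
  have hy0 : 0 < max y m := hm.trans_le hy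
  rw [Real.coe_toNNReal _ (div_nonneg (hs.trans hsb) (sq_nonneg m)), Real.dist_eq, Real.dist_eq]
  have hdiff : s / max x m - s / max y m = s / (max x m * max y m) * (max y m - max x m) := by
    field_simp
  have hmax : |max y m - max x m| ≤ |x - y| := by
    rw [abs_sub_comm x y]
    exact abs_max_sub_max_le_abs y x m
  rw [hdiff, abs_mul, abs_of_nonneg (by positivity)]
  have hprod : m ^ 2 ≤ max x m * max y m := by nlinarith
  have hb : 0 ≤ b := hs.trans hsb
  gcongr

open Set in
/-- Global solvability of `v' = s / v - 1 / √(2 * s)` for data above the nullcline, with the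
bounds obtained from constant barriers. -/
theorem exists_solution_of_nullcline_lt {a b y : ℝ} (ha : 0 < a) (hab : a ≤ b)
    (hy : a * Real.sqrt (2 * a) < y) :
    ∃ v : ℝ → ℝ, v a = y ∧ ∀ s ∈ Icc a b, 0 < v s ∧
      HasDerivWithinAt v (s / v s - 1 / Real.sqrt (2 * s)) (Icc a b) s ∧
      v s ≤ max y (s * Real.sqrt (2 * s)) := by
  set m := a * Real.sqrt (2 * a) with hm_def
  have hsqrt : ∀ s, a ≤ s → 0 < Real.sqrt (2 * s) := fun s hs => Real.sqrt_pos.2 (by linarith)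
  have hm : 0 < m := mul_pos ha (hsqrt a le_rfl)
  have hb : 0 < b := ha.trans_le hab
  obtain ⟨v, hva, hv⟩ := exists_hasDerivWithinAt_Icc_of_lipschitz_of_bounded (y := y)
    (F := fun s x => s / max x m - 1 / Real.sqrt (2 * s)) (K := (b / m ^ 2).toNNReal)
    (L := (b / m + 1 / Real.sqrt (2 * a)).toNNReal) hab
    (fun s hs => by
      have := lipschitzWith_div_max (ha.le.trans hs.1) hs.2 hm
      exact LipschitzWith.of_dist_le_mul fun x z => by
        simpa only [dist_sub_right] using this.dist_le_mul x z)
    (fun x => by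
      have : max x m ≠ 0 := (hm.trans_le (le_max_right _ _)).ne'
      refine ContinuousOn.sub (by fun_prop) (ContinuousOn.div (by fun_prop) (by fun_prop) ?_)
      exact fun s hs => (hsqrt s hs.1).ne')
    (fun s hs x => by
      have h0 := hsqrt a le_rfl
      rw [Real.coe_toNNReal _ (by positivity)]
      refine (norm_sub_le _ _).trans (add_le_add ?_ ?_)
      · have hs0 : 0 < s := ha.trans_le hs.1
        have hx : m ≤ max x m := le_max_right _ _
        rw [Real.norm_of_nonneg (div_nonneg hs0.le (hm.le.trans hx))]
        have := hs.2
        gcongr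
      · rw [Real.norm_of_nonneg (by positivity)]
        have := hs.1
        gcongr)
  have hcont : ContinuousOn v (Icc a b) := fun s hs => (hv s hs).continuousWithinAt
  have hright : ∀ s ∈ Ico a b,
      HasDerivWithinAt v (s / max (v s) m - 1 / Real.sqrt (2 * s)) (Ici s) s := fun s hs =>
    (hv s (Ico_subset_Icc_self hs)).mono_of_mem_nhdsWithin
      (Filter.mem_of_superset (Icc_mem_nhdsGE hs.2) (Icc_subset_Icc_left hs.1))
  have hlow : ∀ s ∈ Icc a b, m ≤ v s := fun s hs => by
    refine neg_le_neg_iff.1 (image_le_of_deriv_right_lt_deriv_boundary (f := fun t => -v t)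
      (B := fun _ => -m) (B' := fun _ => 0) hcont.neg (fun t ht => (hright t ht).neg)
      (by simpa [hva] using hy.le) (fun t => hasDerivAt_const t _) ?_ hs)
    intro t ht heq
    have hvt : v t = m := neg_injective heq
    have hat : a < t := lt_of_le_of_ne ht.1 fun h => by
      rw [← h, hva] at hvt
      exact hy.ne' hvt
    rw [hvt, max_self, neg_lt_zero, sub_pos, one_div_sqrt_lt_div_iff (ha.trans hat) hm]
    exact mul_sqrt_two_mul_lt ha hat
  refine ⟨v, hva, fun s hs => ⟨hm.trans_le (hlow s hs), ?_, ?_⟩⟩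
  · simpa only [max_eq_left (hlow s hs)] using hv s hs
  · have hsub : Icc a s ⊆ Icc a b := Icc_subset_Icc_right hs.2
    refine image_le_of_deriv_right_lt_deriv_boundary (f := v)
      (B := fun _ => max y (s * Real.sqrt (2 * s))) (B' := fun _ => 0) (hcont.mono hsub)
      (fun t ht => hright t ⟨ht.1, ht.2.trans_le hs.2⟩) (hva.trans_le (le_max_left _ _))
      (fun t => hasDerivAt_const t _) ?_ (right_mem_Icc.2 hs.1)
    intro t ht heq
    have hmt := hlow t (hsub (Ico_subset_Icc_self ht))
    have ht0 : 0 < t := ha.trans_le ht.1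
    rw [max_eq_left hmt, sub_neg, div_lt_one_div_sqrt_iff ht0 (hm.trans_le hmt), heq]
    exact (mul_sqrt_two_mul_lt ht0 ht.2).trans_le (le_max_right _ _)

theorem mul_sqrt_two_mul_eq {s : ℝ} (hs : 0 < s) :
    s * Real.sqrt (2 * s) = Real.sqrt 2 * s ^ ((3 : ℝ) / 2) := by
  have h : s ^ ((3 : ℝ) / 2) = s * Real.sqrt s := by
    rw [Real.sqrt_eq_rpow, show (3 : ℝ) / 2 = 1 + 1 / 2 by norm_num, Real.rpow_add hs,
      Real.rpow_one]
  rw [h, Real.sqrt_mul zero_le_two]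
  ring

/-- Existence of the approximating solutions `ṽ_k` of the singular ODE
`ṽ'(s) = s/ṽ(s) - 1/√(2s)` on `[1/k², s₀)` with initial value `ṽ_k(1/k²) = 1/k`,
together with the upper bound `ṽ_k(s) ≤ max {1/k, √2 s^{3/2}}`. -/
theorem stmt_1 (s₀ : ℝ) (hs₀ : 0 < s₀) (k : ℕ) (hk : 2 ≤ k)
    (hks : 1 / (k:ℝ)^2 < s₀) :
    ∃ v : ℝ → ℝ,
      DifferentiableOn ℝ v (Set.Ico (1 / (k:ℝ)^2) s₀) ∧
      v (1 / (k:ℝ)^2) = 1 / (k:ℝ) ∧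
      (∀ s ∈ Set.Ioo (1 / (k:ℝ)^2) s₀, 0 < v s) ∧
      (∀ s ∈ Set.Ioo (1 / (k:ℝ)^2) s₀,
        HasDerivAt v (s / v s - 1 / Real.sqrt (2 * s)) s) ∧
      (∀ s ∈ Set.Ioo (1 / (k:ℝ)^2) s₀,
        v s ≤ max (1 / (k:ℝ)) (Real.sqrt 2 * s ^ ((3:ℝ)/2))) := by
  have hk2 : (2 : ℝ) ≤ k := by exact_mod_cast hk
  have hk0 : (0 : ℝ) < k := by linarith
  have ha : 0 < 1 / (k : ℝ) ^ 2 := by positivity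
  have hy : 1 / (k : ℝ) ^ 2 * Real.sqrt (2 * (1 / (k : ℝ) ^ 2)) < 1 / (k : ℝ) := by
    have hsqrt : Real.sqrt (2 * (1 / (k : ℝ) ^ 2)) < k := by
      rw [Real.sqrt_lt' hk0, mul_one_div, div_lt_iff₀ (by positivity)]
      have : (4 : ℝ) ≤ (k : ℝ) ^ 2 := by nlinarith
      nlinarith
    calc 1 / (k : ℝ) ^ 2 * Real.sqrt (2 * (1 / (k : ℝ) ^ 2)) < 1 / (k : ℝ) ^ 2 * k := by gcongr
      _ = 1 / (k : ℝ) := by field_simp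
  obtain ⟨v, hv0, hv⟩ := exists_solution_of_nullcline_lt ha hks.le hy
  refine ⟨v, fun s hs => ?_, hv0, fun s hs => (hv s (Set.Ioo_subset_Icc_self hs)).1,
    fun s hs => ?_, fun s hs => ?_⟩
  · exact ((hv s (Set.Ico_subset_Icc_self hs)).2.1.mono
      Set.Ico_subset_Icc_self).differentiableWithinAt
  · exact (hv s (Set.Ioo_subset_Icc_self hs)).2.1.hasDerivAt (Icc_mem_nhds hs.1 hs.2)
  · rw [← mul_sqrt_two_mul_eq (ha.trans hs.1)]
    exact (hv s (Set.Ioo_subset_Icc_self hs)).2.2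
end

section
/- Let s₀ > 0 and let k₂ > k₁ ≥ 2 be integers with 1/k₁² < s₀. Suppose that for i = 1, 2 the function ṽ_{k_i} : [1/k_i², s₀) → ℝ is differentiable, satisfies ṽ_{k_i}(1/k_i²) = 1/k_i, ṽ_{k_i}(s) > 0 for s ∈ (1/k_i², s₀), and ṽ_{k_i}'(s) = s/ṽ_{k_i}(s) − 1/√(2s) on (1/k_i², s₀). Then ṽ_{k₂}(s) < ṽ_{k₁}(s) for all s ∈ [1/k₁², s₀). -/
/-- A function starting at a nonpositive value whose derivative is negative wherever the function
is nonnegative becomes strictly negative. -/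
theorem neg_of_deriv_neg_of_nonneg {g g' : ℝ → ℝ} {a b : ℝ} (hab : a < b)
    (hg : ContinuousOn g (Set.Icc a b)) (ha : g a ≤ 0)
    (hd : ∀ x ∈ Set.Ioc a b, HasDerivAt g (g' x) x)
    (hneg : ∀ x ∈ Set.Ioc a b, 0 ≤ g x → g' x < 0) : g b < 0 := by
  by_contra! hb
  obtain ⟨x, hx, hmax⟩ : ∃ x ∈ Set.Ioc a b, ∀ y ∈ Set.Icc a b, g y ≤ g x := by
    obtain ⟨x, hx, hmax⟩ := isCompact_Icc.exists_isMaxOn (Set.nonempty_Icc.2 hab.le) hg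
    rcases hx.1.eq_or_lt with rfl | hlt
    · exact ⟨b, ⟨hab, le_rfl⟩, fun y hy => (hmax hy).trans (ha.trans hb)⟩
    · exact ⟨x, ⟨hlt, hx.2⟩, fun y hy => hmax hy⟩
  have hxneg := hneg x hx (hb.trans (hmax b ⟨hab.le, le_rfl⟩))
  have hslope := (hasDerivAt_iff_tendsto_slope.1 (hd x hx)).mono_left
    (nhdsWithin_mono x (fun y (hy : y < x) => hy.ne) : nhdsWithin x (Set.Iio x) ≤ _)
  refine absurd (ge_of_tendsto hslope ?_) hxneg.not_ge
  filter_upwards [Ioo_mem_nhdsLT hx.1] with y hy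
  rw [slope_def_field]
  exact div_nonneg_of_nonpos (by linarith [hmax y ⟨hy.1.le, hy.2.le.trans hx.2⟩])
    (by linarith [hy.2])

/-- A positive solution of `v' = s / v - 1 / √(2s)` starting on the curve `v = √s` lies strictly
below that curve as long as `s ≤ 1 / 2`. -/
theorem sq_lt_self_of_hasDerivAt {v : ℝ → ℝ} {a b : ℝ} (ha₀ : 0 < a) (hab : a < b)
    (hb : b ≤ 1 / 2) (hv : ContinuousOn v (Set.Icc a b)) (ha : v a ^ 2 = a)
    (hp : ∀ s ∈ Set.Ioc a b, 0 < v s)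
    (ho : ∀ s ∈ Set.Ioc a b, HasDerivAt v (s / v s - 1 / Real.sqrt (2 * s)) s) :
    v b ^ 2 < b := by
  suffices h : v b ^ 2 - b < 0 by linarith
  refine neg_of_deriv_neg_of_nonneg (g := fun s => v s ^ 2 - s) hab
    ((hv.pow 2).sub continuousOn_id) (by simp [ha])
    (fun s hs => ((ho s hs).pow 2).sub (hasDerivAt_id s)) fun s hs _ => ?_
  have hvs := hp s hs
  have hs₀ : 0 < s := ha₀.trans hs.1
  have hsqrt : 0 < Real.sqrt (2 * s) := Real.sqrt_pos.2 (by linarith)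
  have hmul : v s * (s / v s) = s := mul_div_cancel₀ s hvs.ne'
  have hpos : 0 < v s * (1 / Real.sqrt (2 * s)) := by positivity
  norm_num
  norm_num at hpos
  nlinarith [hs.2]

/-- Two positive solutions of `v' = s / v - r s` that agree at the right end point of an interval
agree at the left end point. -/
theorem eq_left_of_eq_right {r v w : ℝ → ℝ} {a b : ℝ} (ha₀ : 0 ≤ a) (hab : a ≤ b)
    (hv : ContinuousOn v (Set.Icc a b)) (hw : ContinuousOn w (Set.Icc a b))
    (hvp : ∀ s ∈ Set.Icc a b, 0 < v s) (hwp : ∀ s ∈ Set.Icc a b, 0 < w s)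
    (hvo : ∀ s ∈ Set.Ioc a b, HasDerivAt v (s / v s - r s) s)
    (hwo : ∀ s ∈ Set.Ioc a b, HasDerivAt w (s / w s - r s) s)
    (hb : v b = w b) : v a = w a := by
  have hne := Set.nonempty_Icc.2 hab
  obtain ⟨x, hx, hxmin⟩ := isCompact_Icc.exists_isMinOn hne hv
  obtain ⟨y, hy, hymin⟩ := isCompact_Icc.exists_isMinOn hne hw
  set m := min (v x) (w y)
  have hm₀ : 0 < m := lt_min (hvp x hx) (hwp y hy)
  have hK : 0 ≤ b / m ^ 2 := by have := ha₀.trans hab; positivity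
  have hlip : ∀ s ∈ Set.Ioc a b,
      LipschitzOnWith ⟨b / m ^ 2, hK⟩ (fun z => s / z - r s) (Set.Ici m) := by
    intro s hs
    refine LipschitzOnWith.of_dist_le_mul fun p hp q hq => ?_
    have hp' : m ≤ p := hp
    have hq' : m ≤ q := hq
    have hp₀ : 0 < p := hm₀.trans_le hp'
    have hq₀ : 0 < q := hm₀.trans_le hq'
    have hs₀ : 0 ≤ s := ha₀.trans hs.1.le
    have hdiff : s / p - r s - (s / q - r s) = -(s / (p * q) * (p - q)) := by
      field_simp
      ring
    rw [Real.dist_eq, Real.dist_eq, hdiff, abs_neg, abs_mul, abs_of_nonneg (by positivity)]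
    refine mul_le_mul_of_nonneg_right ?_ (abs_nonneg _)
    exact div_le_div₀ (hs₀.trans hs.2) hs.2 (by positivity) (by nlinarith)
  exact ODE_solution_unique_of_mem_Icc_left (v := fun s z => s / z - r s)
    (s := fun _ => Set.Ici m) hlip
    hv (fun s hs => (hvo s hs).hasDerivWithinAt)
    (fun s hs => (min_le_left (v x) (w y)).trans (hxmin (Set.Ioc_subset_Icc_self hs)))
    hw (fun s hs => (hwo s hs).hasDerivWithinAt)
    (fun s hs => (min_le_right (v x) (w y)).trans (hymin (Set.Ioc_subset_Icc_self hs)))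
    hb ⟨le_rfl, hab⟩


/-- Monotone dependence on `k` of the approximating solutions `ṽ_k` of the
singular ODE `ṽ'(s) = s/ṽ(s) - 1/√(2s)`: if `k₂ > k₁ ≥ 2` then `ṽ_{k₂} < ṽ_{k₁}` on their
joint interval `[1/k₁², s₀)`. -/
theorem stmt_2 (s₀ : ℝ) (hs₀ : 0 < s₀) (k₁ k₂ : ℕ) (hk₁ : 2 ≤ k₁) (hk : k₁ < k₂)
    (hks : 1 / (k₁:ℝ)^2 < s₀)
    (v₁ v₂ : ℝ → ℝ)
    (hd₁ : DifferentiableOn ℝ v₁ (Set.Ico (1 / (k₁:ℝ)^2) s₀))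
    (hi₁ : v₁ (1 / (k₁:ℝ)^2) = 1 / (k₁:ℝ))
    (hp₁ : ∀ s ∈ Set.Ioo (1 / (k₁:ℝ)^2) s₀, 0 < v₁ s)
    (ho₁ : ∀ s ∈ Set.Ioo (1 / (k₁:ℝ)^2) s₀,
      HasDerivAt v₁ (s / v₁ s - 1 / Real.sqrt (2 * s)) s)
    (hd₂ : DifferentiableOn ℝ v₂ (Set.Ico (1 / (k₂:ℝ)^2) s₀))
    (hi₂ : v₂ (1 / (k₂:ℝ)^2) = 1 / (k₂:ℝ))
    (hp₂ : ∀ s ∈ Set.Ioo (1 / (k₂:ℝ)^2) s₀, 0 < v₂ s)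
    (ho₂ : ∀ s ∈ Set.Ioo (1 / (k₂:ℝ)^2) s₀,
      HasDerivAt v₂ (s / v₂ s - 1 / Real.sqrt (2 * s)) s) :
    ∀ s ∈ Set.Ico (1 / (k₁:ℝ)^2) s₀, v₂ s < v₁ s := by
  have hk₁' : (2 : ℝ) ≤ k₁ := by exact_mod_cast hk₁
  have hk' : (k₁ : ℝ) < k₂ := by exact_mod_cast hk
  have hk₁pos : (0 : ℝ) < k₁ := by linarith
  have hk₂pos : (0 : ℝ) < k₂ := by linarith
  have ha₀ : 0 < 1 / (k₂ : ℝ) ^ 2 := by positivity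
  have hac : 1 / (k₂ : ℝ) ^ 2 < 1 / (k₁ : ℝ) ^ 2 :=
    one_div_lt_one_div_of_lt (by positivity) (by gcongr)
  have hc : 1 / (k₁ : ℝ) ^ 2 ≤ 1 / 2 := one_div_le_one_div_of_le two_pos (by nlinarith)
  have hstart : v₂ (1 / (k₁ : ℝ) ^ 2) < v₁ (1 / (k₁ : ℝ) ^ 2) := by
    have hsq := sq_lt_self_of_hasDerivAt ha₀ hac hc
      (hd₂.continuousOn.mono fun x hx => ⟨hx.1, hx.2.trans_lt hks⟩)
      (by rw [hi₂, one_div_pow])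
      (fun x hx => hp₂ x ⟨hx.1, hx.2.trans_lt hks⟩)
      (fun x hx => ho₂ x ⟨hx.1, hx.2.trans_lt hks⟩)
    rw [hi₁]
    exact lt_of_pow_lt_pow_left₀ 2 (by positivity) (by rwa [one_div_pow])
  set c := 1 / (k₁ : ℝ) ^ 2
  have hc₀ : 0 < c := ha₀.trans hac
  intro s hs
  by_contra! hle
  have hv₁ : ContinuousOn v₁ (Set.Icc c s) :=
    hd₁.continuousOn.mono fun x hx => ⟨hx.1, hx.2.trans_lt hs.2⟩
  have hv₂ : ContinuousOn v₂ (Set.Icc c s) :=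
    hd₂.continuousOn.mono fun x hx => ⟨hac.le.trans hx.1, hx.2.trans_lt hs.2⟩
  obtain ⟨x, hx, hx₀⟩ := intermediate_value_Icc hs.1 (hv₂.sub hv₁)
    (show (0 : ℝ) ∈ Set.Icc (v₂ c - v₁ c) (v₂ s - v₁ s) from
      ⟨by linarith, by linarith⟩)
  have hsub : Set.Icc c x ⊆ Set.Icc c s := Set.Icc_subset_Icc_right hx.2
  have hxs : x < s₀ := hx.2.trans_lt hs.2
  refine hstart.ne (eq_left_of_eq_right (r := fun t => 1 / Real.sqrt (2 * t)) hc₀.le hx.1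
    (hv₂.mono hsub) (hv₁.mono hsub)
    (fun t ht => hp₂ t ⟨hac.trans_le ht.1, ht.2.trans_lt hxs⟩) (fun t ht => ?_)
    (fun t ht => ho₂ t ⟨hac.trans ht.1, ht.2.trans_lt hxs⟩)
    (fun t ht => ho₁ t ⟨ht.1, ht.2.trans_lt hxs⟩) (sub_eq_zero.1 hx₀))
  rcases ht.1.eq_or_lt with rfl | hlt
  · rw [hi₁]
    positivity
  · exact hp₁ t ⟨hlt, ht.2.trans_lt hxs⟩
end

section
/- Let s₀ > 0, let k ≥ 2 be an integer with 1/k² < s₀, and let μ ∈ (0, √2). If ṽ_k : [1/k², s₀) → ℝ is differentiable, satisfies ṽ_k(1/k²) = 1/k, ṽ_k(s) > 0 for s ∈ (1/k², s₀), and ṽ_k'(s) = s/ṽ_k(s) − 1/√(2s) on (1/k², s₀), then ṽ_k(s) ≥ Γ_μ(s) for all s ∈ (1/k², s₀). -/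
/-- The lower barrier `Γ_μ`: for `μ ∈ (0, √2)` and `δ_μ := μ/(3√2)`,
`Γ_μ(s) = (√2 - μ) s^{3/2}` for `s ≤ δ_μ` and `Γ_μ(s) = (√2 - μ) δ_μ^{3/2}` for `s > δ_μ`. -/
noncomputable def Gamma (μ s : ℝ) : ℝ :=
  if s ≤ μ / (3 * Real.sqrt 2) then (Real.sqrt 2 - μ) * s ^ ((3:ℝ)/2)
  else (Real.sqrt 2 - μ) * (μ / (3 * Real.sqrt 2)) ^ ((3:ℝ)/2)

theorem rpow_three_halves {s : ℝ} (hs : 0 ≤ s) : s ^ ((3:ℝ)/2) = s * √s := by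
  rw [show (3:ℝ)/2 = 1 + 1/2 by norm_num, Real.rpow_add_of_nonneg hs (by norm_num) (by norm_num),
    Real.rpow_one, ← Real.sqrt_eq_rpow]

theorem Gamma_eq_min (μ s : ℝ) :
    Gamma μ s = (√2 - μ) * (min s (μ / (3 * √2))) ^ ((3:ℝ)/2) := by
  unfold Gamma
  split_ifs with h
  · rw [min_eq_left h]
  · rw [min_eq_right (not_le.mp h).le]

theorem continuous_Gamma (μ : ℝ) : Continuous (Gamma μ) := by
  rw [funext (Gamma_eq_min μ)]
  exact continuous_const.mul
    ((continuous_id.min continuous_const).rpow_const fun _ => Or.inr (by norm_num))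

theorem hasDerivWithinAt_Gamma {μ s : ℝ} (hs : 0 < s) :
    HasDerivWithinAt (Gamma μ)
      (if s < μ / (3 * √2) then (√2 - μ) * (3 / 2 * √s) else 0) (Set.Ici s) s := by
  split_ifs with h
  · have h1 := (Real.hasDerivAt_rpow_const (x := s) (p := (3:ℝ)/2) (Or.inl hs.ne')).const_mul
      (√2 - μ)
    rw [show (3:ℝ)/2 - 1 = 1/2 by norm_num, ← Real.sqrt_eq_rpow] at h1
    refine (h1.congr_of_eventuallyEq ?_).hasDerivWithinAt
    filter_upwards [Iio_mem_nhds h] with x hx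
    exact if_pos (Set.mem_Iio.mp hx).le
  · have h : μ / (3 * √2) ≤ s := not_lt.mp h
    refine (hasDerivWithinAt_const s _
      ((√2 - μ) * (μ / (3 * √2)) ^ ((3:ℝ)/2))).congr ?_ ?_
    · intro x hx
      rw [Gamma_eq_min, min_eq_right (h.trans hx)]
    · rw [Gamma_eq_min, min_eq_right h]

/-- `Γ_μ` is a strict subsolution of the singular ODE. -/
theorem Gamma_strict_subsolution {μ s : ℝ} (hμ : μ ∈ Set.Ioo 0 (√2)) (hs : 0 < s) :
    (if s < μ / (3 * √2) then (√2 - μ) * (3 / 2 * √s) else 0) <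
      s / Gamma μ s - 1 / √(2 * s) := by
  obtain ⟨hμ0, hμ2⟩ := hμ
  have ht : √2 * √2 = 2 := Real.mul_self_sqrt (by norm_num)
  have ht0 : 0 < √2 := by positivity
  have hc : 0 < √2 - μ := sub_pos.mpr hμ2
  have hu : 0 < √s := Real.sqrt_pos.mpr hs
  have hus : √s * √s = s := Real.mul_self_sqrt hs.le
  have hδ : 0 < μ / (3 * √2) := by positivity
  rw [Real.sqrt_mul (by norm_num : (0:ℝ) ≤ 2)]
  split_ifs with h
  · have hG : Gamma μ s = (√2 - μ) * (s * √s) := by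
      rw [Gamma_eq_min, min_eq_left h.le, rpow_three_halves hs.le]
    have h3 : s * (3 * √2) < μ := (lt_div_iff₀ (by positivity)).mp h
    have hE : s / Gamma μ s - 1 / (√2 * √s) = μ / (√2 * (√2 - μ) * √s) := by
      rw [hG]
      field_simp
      ring
    rw [hE, lt_div_iff₀ (by positivity)]
    have hc2 : (√2 - μ) ^ 2 ≤ 2 := by nlinarith
    calc (√2 - μ) * (3 / 2 * √s) * (√2 * (√2 - μ) * √s)
        = (√2 - μ) ^ 2 * (s * (3 * √2)) / 2 := by
          linear_combination (3 / 2 * √2 * (√2 - μ) ^ 2) * hus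
      _ ≤ 2 * (s * (3 * √2)) / 2 := by gcongr
      _ < μ := by linarith
  · have h : μ / (3 * √2) ≤ s := not_lt.mp h
    have hG : Gamma μ s = (√2 - μ) * (μ / (3 * √2)) ^ ((3:ℝ)/2) := by
      rw [Gamma_eq_min, min_eq_right h]
    have hG0 : 0 < Gamma μ s := by rw [hG]; positivity
    have hGle : Gamma μ s ≤ (√2 - μ) * (s * √s) := by
      rw [hG, ← rpow_three_halves hs.le]
      gcongr
    rw [sub_pos, div_lt_div_iff₀ (by positivity) hG0]
    have : 0 < μ * (s * √s) := by positivity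
    linarith

theorem Gamma_lt_sqrt {μ s : ℝ} (hμ : μ ∈ Set.Ioo 0 (√2)) (hs : 0 < s) (hs4 : s ≤ 1 / 4) :
    Gamma μ s < √s := by
  obtain ⟨hμ0, hμ2⟩ := hμ
  have hc : 0 < √2 - μ := sub_pos.mpr hμ2
  have hδ : 0 < μ / (3 * √2) := by positivity
  have hu : 0 < √s := Real.sqrt_pos.mpr hs
  have ht : √2 < 2 := by rw [Real.sqrt_lt' (by norm_num)]; norm_num
  calc Gamma μ s ≤ (√2 - μ) * s ^ ((3:ℝ)/2) := by
        rw [Gamma_eq_min]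
        gcongr
        exact min_le_left _ _
    _ = ((√2 - μ) * s) * √s := by rw [rpow_three_halves hs.le]; ring
    _ < 1 * √s := by
        gcongr
        nlinarith
    _ = √s := one_mul _

/-- Uniform lower bound `ṽ_k ≥ Γ_μ` for the approximating solutions of the
singular ODE `ṽ'(s) = s/ṽ(s) - 1/√(2s)` with `ṽ_k(1/k²) = 1/k`. -/
theorem stmt_3 (s₀ : ℝ) (hs₀ : 0 < s₀) (k : ℕ) (hk : 2 ≤ k)
    (hks : 1 / (k:ℝ)^2 < s₀) (μ : ℝ) (hμ : μ ∈ Set.Ioo 0 (Real.sqrt 2))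
    (v : ℝ → ℝ)
    (hd : DifferentiableOn ℝ v (Set.Ico (1 / (k:ℝ)^2) s₀))
    (hi : v (1 / (k:ℝ)^2) = 1 / (k:ℝ))
    (hp : ∀ s ∈ Set.Ioo (1 / (k:ℝ)^2) s₀, 0 < v s)
    (ho : ∀ s ∈ Set.Ioo (1 / (k:ℝ)^2) s₀,
      HasDerivAt v (s / v s - 1 / Real.sqrt (2 * s)) s) :
    ∀ s ∈ Set.Ioo (1 / (k:ℝ)^2) s₀, Gamma μ s ≤ v s := by
  intro s hs
  have hk2 : (2:ℝ) ≤ k := by exact_mod_cast hk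
  have ha : 0 < 1 / (k:ℝ)^2 := by positivity
  have ha4 : 1 / (k:ℝ)^2 ≤ 1 / 4 := by
    gcongr
    nlinarith
  have hsqrt : √(1 / (k:ℝ)^2) = 1 / (k:ℝ) := by
    rw [← one_div_pow, Real.sqrt_sq (by positivity)]
  have hlt : Gamma μ (1 / (k:ℝ)^2) < v (1 / (k:ℝ)^2) := by
    rw [hi, ← hsqrt]
    exact Gamma_lt_sqrt hμ ha ha4
  refine image_le_of_deriv_right_lt_deriv_boundary'
    (B' := fun x => derivWithin v (Set.Ici x) x) (continuous_Gamma μ).continuousOn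
    (fun x hx => hasDerivWithinAt_Gamma (ha.trans_le hx.1)) hlt.le
    (hd.continuousOn.mono (Set.Icc_subset_Ico_right hs.2)) ?_ ?_
    (Set.right_mem_Icc.mpr hs.1.le)
  · intro x hx
    have hx0 : x < s₀ := hx.2.trans hs.2
    have h1 := (hd x ⟨hx.1, hx0⟩).mono (Set.Ico_subset_Ico_left hx.1)
    exact (h1.mono_of_mem_nhdsWithin (Ico_mem_nhdsGE hx0)).hasDerivWithinAt
  · intro x hx hxe
    rcases hx.1.eq_or_lt with rfl | hax
    · exact absurd hxe hlt.ne
    · have hv := (ho x ⟨hax, hx.2.trans hs.2⟩).hasDerivWithinAt.derivWithin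
        (uniqueDiffWithinAt_Ici x)
      have := Gamma_strict_subsolution hμ (ha.trans hax)
      rw [hxe] at this
      rwa [hv]
end

section
/- For every s₀ > 0 there exists a differentiable function ṽ : (0, s₀) → ℝ such that ṽ(s) > 0 and ṽ'(s) = s/ṽ(s) − 1/√(2s) for all s ∈ (0, s₀), lim_{s→0⁺} ṽ(s) = 0, ∫₀^{s₀} ds/ṽ(s) = +∞, and Γ_μ(s) ≤ ṽ(s) ≤ √2 · s^{3/2} for every μ ∈ (0, √2) and every s ∈ (0, s₀); in particular ṽ(s)/s^{3/2} → √2 as s → 0⁺. -/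
namespace SingularODE

open Set Filter Topology MeasureTheory

/-- The right-hand side `s / y - 1 / √(2s)` of the singular equation. -/
noncomputable def field (s y : ℝ) : ℝ := s / y - 1 / Real.sqrt (2 * s)

/-- The nullcline `√2 s^{3/2}` of `field`, which is the upper barrier. -/
noncomputable def upper (s : ℝ) : ℝ := Real.sqrt 2 * s ^ ((3:ℝ)/2)

/-- Positive solutions of the singular equation on `[a, b]`. -/
def IsPosSol (a b : ℝ) (v : ℝ → ℝ) : Prop :=
  ∀ s ∈ Icc a b, 0 < v s ∧ HasDerivWithinAt v (field s (v s)) (Icc a b) s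

lemma sqrt_two_pos : 0 < Real.sqrt 2 := Real.sqrt_pos.2 two_pos

lemma rpow_three_halves {s : ℝ} (hs : 0 < s) : s ^ ((3:ℝ)/2) = s * Real.sqrt s := by
  rw [Real.sqrt_eq_rpow, ← Real.rpow_one_add' hs.le (by norm_num)]
  norm_num

lemma hasDerivAt_rpow_three_halves {s : ℝ} (hs : 0 < s) :
    HasDerivAt (fun x : ℝ => x ^ ((3:ℝ)/2)) (3 / 2 * Real.sqrt s) s := by
  have h := Real.hasDerivAt_rpow_const (x := s) (p := (3:ℝ)/2) (Or.inl hs.ne')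
  rw [Real.sqrt_eq_rpow]
  convert h using 2
  norm_num

lemma upper_pos {s : ℝ} (hs : 0 < s) : 0 < upper s :=
  mul_pos sqrt_two_pos (Real.rpow_pos_of_pos hs _)

lemma upper_mono {s t : ℝ} (hs : 0 ≤ s) (hst : s ≤ t) : upper s ≤ upper t :=
  mul_le_mul_of_nonneg_left (Real.rpow_le_rpow hs hst (by norm_num)) sqrt_two_pos.le

lemma field_upper {s : ℝ} (hs : 0 < s) : field s (upper s) = 0 := by
  have := sqrt_two_pos
  have := Real.sqrt_pos.2 hs
  rw [field, upper, rpow_three_halves hs, Real.sqrt_mul two_pos.le]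
  field_simp
  ring

lemma field_anti {s x y : ℝ} (hs : 0 < s) (hx : 0 < x) (hxy : x ≤ y) : field s y ≤ field s x :=
  sub_le_sub_right (div_le_div_of_nonneg_left hs.le hx hxy) _

lemma field_nonneg {s x : ℝ} (hs : 0 < s) (hx : 0 < x) (hxs : x ≤ upper s) : 0 ≤ field s x :=
  (field_upper hs).ge.trans (field_anti hs hx hxs)

lemma abs_field_le {a b c s y : ℝ} (ha : 0 < a) (hc : 0 < c) (hs : s ∈ Icc a b) (hy : c ≤ y) :
    |field s y| ≤ b / c + 1 / Real.sqrt (2 * a) := by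
  have h0 : 0 < s := ha.trans_le hs.1
  have h1 : 0 ≤ s / y := div_nonneg h0.le (hc.le.trans hy)
  have h2 : s / y ≤ b / c := div_le_div₀ (h0.le.trans hs.2) hs.2 hc hy
  have h3 : 0 ≤ 1 / Real.sqrt (2 * s) := by positivity
  have h4 : 1 / Real.sqrt (2 * s) ≤ 1 / Real.sqrt (2 * a) := by
    apply one_div_le_one_div_of_le (Real.sqrt_pos.2 (by positivity))
    exact Real.sqrt_le_sqrt (by linarith [hs.1])
  rw [field, abs_le]
  constructor <;> linarith

lemma continuousOn_field {S : Set ℝ} {v : ℝ → ℝ} (hS : ∀ s ∈ S, 0 < s) (hv : ContinuousOn v S)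
    (hpos : ∀ s ∈ S, 0 < v s) : ContinuousOn (fun s => field s (v s)) S := by
  refine (continuousOn_id.div hv fun s hs => (hpos s hs).ne').sub
    (continuousOn_const.div (by fun_prop) fun s hs => ?_)
  exact (Real.sqrt_pos.2 (mul_pos two_pos (hS s hs))).ne'

lemma nonpos_of_deriv_nonpos {g g' : ℝ → ℝ} {a b : ℝ}
    (hg : ∀ x ∈ Icc a b, HasDerivWithinAt g (g' x) (Icc a b) x)
    (hg' : ∀ x ∈ Icc a b, 0 < g x → g' x ≤ 0) (ha : g a ≤ 0) :
    ∀ x ∈ Icc a b, g x ≤ 0 := by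
  intro x hx
  have key : ∀ η > 0, g x ≤ η * (1 + (x - a)) := by
    intro η hη
    refine image_le_of_deriv_right_lt_deriv_boundary' (f := g) (f' := g')
      (B := fun x => η * (1 + (x - a))) (B' := fun _ => η)
      (fun y hy => (hg y hy).continuousWithinAt)
      (fun y hy => (hg y (Ico_subset_Icc_self hy)).mono_of_mem_nhdsWithin
        (Icc_mem_nhdsGE_of_mem hy)) (by simp; linarith) (by fun_prop) ?_ ?_ hx
    · intro y _
      have := (((hasDerivAt_id y).sub_const a).const_add 1).const_mul η
      simpa using this.hasDerivWithinAt
    · intro y hy hxy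
      refine (hg' y (Ico_subset_Icc_self hy) ?_).trans_lt hη
      rw [hxy]
      have := hy.1
      exact mul_pos hη (by linarith)
  have hx1 : 0 < 1 + (x - a) := by linarith [hx.1]
  by_contra! h
  have := key (g x / (2 * (1 + (x - a)))) (by positivity)
  have h2 : g x / (2 * (1 + (x - a))) * (1 + (x - a)) = g x / 2 := by field_simp
  linarith

namespace IsPosSol

variable {a b : ℝ} {v w w' : ℝ → ℝ}

lemma mono {c : ℝ} (hv : IsPosSol a b v) (hac : a ≤ c) : IsPosSol c b v := fun s hs =>
  have hs' := Icc_subset_Icc_left hac hs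
  ⟨(hv s hs').1, (hv s hs').2.mono (Icc_subset_Icc_left hac)⟩

lemma continuousOn (hv : IsPosSol a b v) : ContinuousOn v (Icc a b) :=
  fun s hs => (hv s hs).2.continuousWithinAt

lemma subsolution_le (ha : 0 < a) (hv : IsPosSol a b v) {c : ℝ} (hc : c ≤ b)
    (hwd : ∀ s ∈ Icc a c, HasDerivWithinAt w (w' s) (Icc a c) s)
    (hsub : ∀ s ∈ Icc a c, w' s ≤ field s (w s)) (h0 : w a ≤ v a) :
    ∀ s ∈ Icc a c, w s ≤ v s := by
  have hss : Icc a c ⊆ Icc a b := Icc_subset_Icc_right hc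
  have := nonpos_of_deriv_nonpos (g := fun s => w s - v s) (a := a) (b := c)
    (fun x hx => (hwd x hx).sub ((hv x (hss hx)).2.mono hss)) (fun x hx hpos => by
      have := field_anti (ha.trans_le hx.1) (hv x (hss hx)).1 (sub_pos.1 hpos).le
      linarith [hsub x hx]) (by linarith)
  intro s hs
  linarith [this s hs]

lemma le_supersolution (ha : 0 < a) (hv : IsPosSol a b v)
    (hw : ∀ s ∈ Icc a b, 0 < w s) (hwd : ∀ s ∈ Icc a b, HasDerivWithinAt w (w' s) (Icc a b) s)
    (hsup : ∀ s ∈ Icc a b, field s (w s) ≤ w' s) (h0 : v a ≤ w a) :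
    ∀ s ∈ Icc a b, v s ≤ w s := by
  have := nonpos_of_deriv_nonpos (g := fun s => v s - w s) (a := a) (b := b)
    (fun x hx => (hv x hx).2.sub (hwd x hx)) (fun x hx hpos => by
      have := field_anti (ha.trans_le hx.1) (hw x hx) (sub_pos.1 hpos).le
      linarith [hsup x hx]) (by linarith)
  intro s hs
  linarith [this s hs]

lemma le_upper (ha : 0 < a) (hv : IsPosSol a b v) (h0 : v a ≤ upper a) :
    ∀ s ∈ Icc a b, v s ≤ upper s := by
  refine hv.le_supersolution ha (w' := fun s => Real.sqrt 2 * (3 / 2 * Real.sqrt s))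
    (fun s hs => upper_pos (ha.trans_le hs.1))
    (fun s hs =>
      ((hasDerivAt_rpow_three_halves (ha.trans_le hs.1)).const_mul _).hasDerivWithinAt)
    (fun s hs => ?_) h0
  rw [field_upper (ha.trans_le hs.1)]
  positivity

lemma const_le {c : ℝ} (ha : 0 < a) (hv : IsPosSol a b v) (hc : 0 < c) (hca : c ≤ upper a)
    (h0 : c ≤ v a) : ∀ s ∈ Icc a b, c ≤ v s :=
  hv.subsolution_le ha le_rfl (w := fun _ => c) (w' := fun _ => 0)
    (fun _ _ => hasDerivWithinAt_const _ _ _)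
    (fun _ hs => field_nonneg (ha.trans_le hs.1) hc (hca.trans (upper_mono ha.le hs.1))) h0

end IsPosSol

lemma Gamma_pos {μ s : ℝ} (hμ : μ ∈ Ioo 0 (Real.sqrt 2)) (hs : 0 < s) : 0 < Gamma μ s := by
  have h1 : 0 < Real.sqrt 2 - μ := sub_pos.2 hμ.2
  have h2 : 0 < μ / (3 * Real.sqrt 2) := div_pos hμ.1 (mul_pos three_pos sqrt_two_pos)
  unfold Gamma
  split_ifs
  · exact mul_pos h1 (Real.rpow_pos_of_pos hs _)
  · exact mul_pos h1 (Real.rpow_pos_of_pos h2 _)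

lemma Gamma_mono {μ s t : ℝ} (hμ : μ ∈ Ioo 0 (Real.sqrt 2)) (hs : 0 < s) (hst : s ≤ t) :
    Gamma μ s ≤ Gamma μ t := by
  have h1 : 0 ≤ Real.sqrt 2 - μ := (sub_pos.2 hμ.2).le
  unfold Gamma
  split_ifs with h h' h'
  · exact mul_le_mul_of_nonneg_left (Real.rpow_le_rpow hs.le hst (by norm_num)) h1
  · exact mul_le_mul_of_nonneg_left (Real.rpow_le_rpow hs.le h (by norm_num)) h1
  · exact absurd (hst.trans h') h
  · exact le_rfl

lemma Gamma_le_upper {μ s : ℝ} (hμ : μ ∈ Ioo 0 (Real.sqrt 2)) (hs : 0 < s) :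
    Gamma μ s ≤ upper s := by
  have h1 : Real.sqrt 2 - μ ≤ Real.sqrt 2 := by linarith [hμ.1]
  have h2 : 0 < μ / (3 * Real.sqrt 2) := div_pos hμ.1 (mul_pos three_pos sqrt_two_pos)
  unfold Gamma
  split_ifs with h
  · exact mul_le_mul_of_nonneg_right h1 (Real.rpow_nonneg hs.le _)
  · exact mul_le_mul h1 (Real.rpow_le_rpow h2.le (not_le.1 h).le (by norm_num))
      (Real.rpow_nonneg h2.le _) sqrt_two_pos.le

lemma deriv_le_field_of_le {μ s : ℝ} (hμ : μ ∈ Ioo 0 (Real.sqrt 2)) (hs : 0 < s)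
    (hsδ : s ≤ μ / (3 * Real.sqrt 2)) :
    (Real.sqrt 2 - μ) * (3 / 2 * Real.sqrt s) ≤
      field s ((Real.sqrt 2 - μ) * s ^ ((3:ℝ)/2)) := by
  have h2 := sqrt_two_pos
  have h22 : Real.sqrt 2 ^ 2 = 2 := Real.sq_sqrt two_pos.le
  have hr := Real.sqrt_pos.2 hs
  have hrr : Real.sqrt s ^ 2 = s := Real.sq_sqrt hs.le
  have hk : 0 < Real.sqrt 2 - μ := sub_pos.2 hμ.2
  rw [field, rpow_three_halves hs, Real.sqrt_mul two_pos.le]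
  have hμ0 := hμ.1
  rw [le_div_iff₀ (by positivity)] at hsδ
  set q := Real.sqrt 2
  set r := Real.sqrt s
  have e : s / ((q - μ) * (s * r)) - 1 / (q * r) = μ / ((q - μ) * q * r) := by
    field_simp
    ring
  rw [e, le_div_iff₀ (by positivity)]
  have hk2 : (q - μ) ^ 2 ≤ 2 := by rw [← h22]; exact pow_le_pow_left₀ hk.le (by linarith) 2
  calc (q - μ) * (3 / 2 * r) * ((q - μ) * q * r) = (q - μ) ^ 2 * (3 / 2 * q * r ^ 2) := by ring
    _ ≤ 2 * (3 / 2 * q * r ^ 2) := by gcongr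
    _ = s * (3 * q) := by rw [hrr]; ring
    _ ≤ μ := hsδ

lemma IsPosSol.Gamma_le {a b μ : ℝ} {v : ℝ → ℝ} (ha : 0 < a) (hv : IsPosSol a b v)
    (h0 : v a = upper a) (hμ : μ ∈ Ioo 0 (Real.sqrt 2)) : ∀ s ∈ Icc a b, Gamma μ s ≤ v s := by
  intro s hs
  set δ := μ / (3 * Real.sqrt 2)
  have hδ0 : 0 < δ := div_pos hμ.1 (mul_pos three_pos sqrt_two_pos)
  have hlow : ∀ c ≤ b, c ≤ δ → ∀ t ∈ Icc a c, Gamma μ t ≤ v t := by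
    intro c hcb hcδ t ht
    rw [Gamma, if_pos (ht.2.trans hcδ)]
    refine hv.subsolution_le ha hcb (w := fun t => (Real.sqrt 2 - μ) * t ^ ((3:ℝ)/2))
      (w' := fun t => (Real.sqrt 2 - μ) * (3 / 2 * Real.sqrt t))
      (fun x hx =>
        ((hasDerivAt_rpow_three_halves (ha.trans_le hx.1)).const_mul _).hasDerivWithinAt)
      (fun x hx => deriv_le_field_of_le hμ (ha.trans_le hx.1) (hx.2.trans hcδ)) ?_ t ht
    rw [h0]
    exact mul_le_mul_of_nonneg_right (by linarith [hμ.1]) (Real.rpow_nonneg ha.le _)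
  rcases le_or_gt s δ with hsδ | hsδ
  · exact hlow s hs.2 hsδ s ⟨hs.1, le_rfl⟩
  · have hs' : ∀ c, δ ≤ c → Gamma μ c = Gamma μ δ := fun c hc => by
      rcases hc.eq_or_lt with rfl | hc
      · rfl
      · rw [Gamma, if_neg (not_le.2 hc), Gamma, if_pos le_rfl]
    have key : ∀ c ∈ Icc a b, δ ≤ c → c ≤ s → Gamma μ c ≤ v c → Gamma μ s ≤ v s := by
      intro c hc hδc hcs hle
      rw [hs' s hsδ.le, ← hs' c hδc]
      have hc0 := ha.trans_le hc.1
      exact (hv.mono hc.1).const_le hc0 (Gamma_pos hμ hc0) (Gamma_le_upper hμ hc0) hle s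
        ⟨hcs, hs.2⟩
    rcases le_total a δ with haδ | haδ
    · have hδb := hsδ.le.trans hs.2
      exact key δ ⟨haδ, hδb⟩ le_rfl hsδ.le (hlow δ hδb le_rfl δ ⟨haδ, le_rfl⟩)
    · exact key a ⟨le_rfl, hs.1.trans hs.2⟩ haδ hs.1 (h0 ▸ Gamma_le_upper hμ ha)

lemma exists_isPosSol {a b : ℝ} (ha : 0 < a) (hab : a ≤ b) :
    ∃ v : ℝ → ℝ, v a = upper a ∧ IsPosSol a b v := by
  set c := upper a
  have hc : 0 < c := upper_pos ha
  have hb : 0 < b := ha.trans_le hab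
  have hmax : ∀ x : ℝ, 0 < max x c := fun x => hc.trans_le (le_max_right _ _)
  set M : ℝ := b / c + 1 / Real.sqrt (2 * a)
  have hM : 0 ≤ M := by positivity
  have hpl : IsPicardLindelof (fun t x => field t (max x c)) (⟨a, le_rfl, hab⟩ : Icc a b) c
      (M * (b - a)).toNNReal 0 M.toNNReal (b / c ^ 2).toNNReal := by
    refine ⟨fun t ht => ?_, fun x _ => ?_, fun t ht x _ => ?_, ?_⟩
    · refine LipschitzOnWith.of_dist_le_mul fun x _ y _ => ?_
      have ht0 : 0 < t := ha.trans_le ht.1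
      rw [Real.coe_toNNReal _ (by positivity), Real.dist_eq, Real.dist_eq]
      have e : field t (max x c) - field t (max y c) =
          t / (max x c * max y c) * (max y c - max x c) := by
        have := (hmax x).ne'
        have := (hmax y).ne'
        unfold field
        field_simp
        ring
      rw [e, abs_mul, abs_of_nonneg (div_nonneg ht0.le (mul_pos (hmax x) (hmax y)).le)]
      refine mul_le_mul (div_le_div₀ hb.le ht.2 (by positivity) ?_) ?_ (abs_nonneg _)
        (by positivity)
      · rw [sq]
        exact mul_le_mul (le_max_right _ _) (le_max_right _ _) hc.le (hmax x).le
      · rw [abs_sub_comm x y]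
        exact abs_max_sub_max_le_abs y x c
    · exact continuousOn_field (fun s hs => ha.trans_le hs.1) continuousOn_const fun _ _ => hmax x
    · rw [Real.coe_toNNReal _ hM]
      exact abs_field_le ha hc ht (le_max_right _ _)
    · rw [Real.coe_toNNReal _ hM, Real.coe_toNNReal _ (mul_nonneg hM (sub_nonneg.2 hab))]
      simp [hab]
  obtain ⟨v, hva, hv⟩ := hpl.exists_eq_forall_mem_Icc_hasDerivWithinAt₀
  have hva : v a = c := hva
  have hcv := nonpos_of_deriv_nonpos (g := fun s => c - v s)
    (fun x hx => (hv x hx).const_sub c) (fun x hx hpos => by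
      have hx0 := ha.trans_le hx.1
      rw [max_eq_right (sub_pos.1 hpos).le]
      linarith [field_nonneg hx0 hc (upper_mono ha.le hx.1)]) (by simp [hva])
  refine ⟨v, hva, fun s hs => ?_⟩
  have h : c ≤ v s := by linarith [hcv s hs]
  have hd := hv s hs
  rw [max_eq_left h] at hd
  exact ⟨hc.trans_le h, hd⟩

lemma hasDerivAt_of_tendsto {a b m : ℝ} (ha : 0 < a) (hm : 0 < m) {W : ℕ → ℝ → ℝ} {v : ℝ → ℝ}
    (hW : ∀ᶠ n in atTop, IsPosSol a b (W n) ∧ ∀ s ∈ Icc a b, m ≤ W n s)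
    (hlim : ∀ s ∈ Icc a b, Tendsto (fun n => W n s) atTop (𝓝 (v s))) :
    ∀ s ∈ Ioo a b, HasDerivAt v (field s (v s)) s := by
  intro s hs
  have hab : a < b := hs.1.trans hs.2
  have hvm : ∀ t ∈ Icc a b, m ≤ v t := fun t ht =>
    ge_of_tendsto (hlim t ht) (hW.mono fun n hn => hn.2 t ht)
  set M : ℝ := b / m + 1 / Real.sqrt (2 * a)
  have hM : 0 ≤ M := by
    have := ha.trans hab
    positivity
  have hvc : ContinuousOn v (Icc a b) := by
    refine LipschitzOnWith.continuousOn (K := M.toNNReal)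
      (LipschitzOnWith.of_dist_le_mul fun x hx y hy => ?_)
    rw [Real.coe_toNNReal _ hM, Real.dist_eq, Real.dist_eq]
    refine le_of_tendsto ((hlim x hx).sub (hlim y hy)).abs (hW.mono fun n hn => ?_)
    exact (convex_Icc a b).norm_image_sub_le_of_norm_hasDerivWithin_le
      (fun z hz => (hn.1 z hz).2) (fun z hz => abs_field_le ha hm hz (hn.2 z hz)) hy hx
  have hfc : ContinuousOn (fun r => field r (v r)) (Icc a b) :=
    continuousOn_field (fun r hr => ha.trans_le hr.1) hvc fun r hr => hm.trans_le (hvm r hr)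
  have hint : ∀ t ∈ Icc a b, v t = v a + ∫ r in a..t, field r (v r) := by
    intro t ht
    have hss : Icc a t ⊆ Icc a b := Icc_subset_Icc_right ht.2
    have hwc : ∀ n, IsPosSol a b (W n) → ContinuousOn (fun r => field r (W n r)) (Icc a t) :=
      fun n hn => (continuousOn_field (fun r hr => ha.trans_le hr.1) hn.continuousOn
        fun r hr => (hn r hr).1).mono hss
    have huIoc : uIoc a t = Ioc a t := uIoc_of_le ht.1
    have h1 : Tendsto (fun n => ∫ r in a..t, field r (W n r)) atTop
        (𝓝 (∫ r in a..t, field r (v r))) := by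
      refine intervalIntegral.tendsto_integral_filter_of_dominated_convergence (fun _ => M)
        (hW.mono fun n hn => ?_) (hW.mono fun n hn => ae_of_all _ fun r hr => ?_)
        intervalIntegrable_const (ae_of_all _ fun r hr => ?_)
      · rw [huIoc]
        exact ((hwc n hn.1).mono Ioc_subset_Icc_self).aestronglyMeasurable measurableSet_Ioc
      · rw [huIoc] at hr
        have hr' := hss (Ioc_subset_Icc_self hr)
        exact abs_field_le ha hm hr' (hn.2 r hr')
      · rw [huIoc] at hr
        have hr' := hss (Ioc_subset_Icc_self hr)
        exact (tendsto_const_nhds.div (hlim r hr') (hm.trans_le (hvm r hr')).ne').sub_const _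
    have h2 : Tendsto (fun n => ∫ r in a..t, field r (W n r)) atTop (𝓝 (v t - v a)) := by
      refine ((hlim t ht).sub (hlim a ⟨le_rfl, hab.le⟩)).congr' (hW.mono fun n hn => ?_)
      refine (intervalIntegral.integral_eq_sub_of_hasDerivAt_of_le ht.1
        (hn.1.continuousOn.mono hss) (fun x hx => ?_)
        ((hwc n hn.1).intervalIntegrable_of_Icc ht.1)).symm
      exact (hn.1 x ⟨hx.1.le, hx.2.le.trans ht.2⟩).2.hasDerivAt
        (Icc_mem_nhds hx.1 (hx.2.trans_le ht.2))
    linarith [tendsto_nhds_unique h1 h2]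
  have hnhds : Icc a b ∈ 𝓝 s := Icc_mem_nhds hs.1 hs.2
  have hd : HasDerivAt (fun t => ∫ r in a..t, field r (v r)) (field s (v s)) s :=
    intervalIntegral.integral_hasDerivAt_right
      ((hfc.mono (Icc_subset_Icc_right hs.2.le)).intervalIntegrable_of_Icc hs.1.le)
      ((hfc.mono Ioo_subset_Icc_self).stronglyMeasurableAtFilter isOpen_Ioo s hs)
      (hfc.continuousAt hnhds)
  exact (hd.const_add (v a)).congr_of_eventuallyEq (eventually_of_mem hnhds hint)

/-- A decreasing sequence of solutions, issued from points of the upper barrier that tend to the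
singular time `0`, converges to a solution on `(0, T)` lying between the barriers. -/
lemma exists_solution_between {T : ℝ} (hT : 0 < T) :
    ∃ v : ℝ → ℝ, ∀ s ∈ Ioo 0 T, HasDerivAt v (field s (v s)) s ∧ v s ≤ upper s ∧
      ∀ μ ∈ Ioo 0 (Real.sqrt 2), Gamma μ s ≤ v s := by
  set a : ℕ → ℝ := fun n => T / (n + 1)
  have ha : ∀ n, 0 < a n := fun n => by positivity
  have haT : ∀ n, a n ≤ T := fun n => div_le_self hT.le (by linarith [n.cast_nonneg (α := ℝ)])
  have ha_anti : Antitone a := fun m n hmn => by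
    have : (m : ℝ) ≤ n := Nat.cast_le.2 hmn
    exact div_le_div_of_nonneg_left hT.le (by positivity) (by linarith)
  have ha_lim : Tendsto a atTop (𝓝 0) := by
    have := tendsto_one_div_add_atTop_nhds_zero_nat (𝕜 := ℝ).const_mul T
    simpa [a, div_eq_mul_inv] using this
  choose V hV0 hV using fun n => exists_isPosSol (ha n) (haT n)
  set W : ℕ → ℝ → ℝ := fun n s => if s < a n then upper s else V n s
  have hWV : ∀ n s, a n ≤ s → W n s = V n s := fun n s h => if_neg h.not_gt
  have hWU : ∀ n, ∀ s ∈ Ioc 0 T, W n s ≤ upper s := by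
    intro n s hs
    simp only [W]
    split_ifs with h
    · exact le_rfl
    · exact (hV n).le_upper (ha n) (hV0 n).le s ⟨not_lt.1 h, hs.2⟩
  have hWΓ : ∀ n, ∀ s ∈ Ioc 0 T, ∀ μ ∈ Ioo 0 (Real.sqrt 2), Gamma μ s ≤ W n s := by
    intro n s hs μ hμ
    simp only [W]
    split_ifs with h
    · exact Gamma_le_upper hμ hs.1
    · exact (hV n).Gamma_le (ha n) (hV0 n) hμ s ⟨not_lt.1 h, hs.2⟩
  have hWanti : ∀ s ∈ Ioc 0 T, Antitone fun n => W n s := by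
    intro s hs m n hmn
    rcases lt_or_ge s (a m) with h | h
    · exact (hWU n s hs).trans (if_pos h).ge
    · have hnm := ha_anti hmn
      simp only [hWV n s (hnm.trans h), hWV m s h]
      refine ((hV n).mono hnm).le_supersolution (ha m) (fun x hx => (hV m x hx).1)
        (fun x hx => (hV m x hx).2) (fun _ _ => le_rfl) ?_ s ⟨h, hs.2⟩
      rw [hV0 m]
      exact (hV n).le_upper (ha n) (hV0 n).le _ ⟨hnm, haT m⟩
  obtain ⟨ν, hν⟩ : (Ioo 0 (Real.sqrt 2)).Nonempty := nonempty_Ioo.2 sqrt_two_pos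
  have hlim : ∀ s ∈ Ioc 0 T, Tendsto (fun n => W n s) atTop (𝓝 (⨅ n, W n s)) := fun s hs =>
    tendsto_atTop_ciInf (hWanti s hs)
      ⟨Gamma ν s, by rintro _ ⟨n, rfl⟩; exact hWΓ n s hs ν hν⟩
  refine ⟨fun s => ⨅ n, W n s, fun s hs => ?_⟩
  have hs' : s ∈ Ioc 0 T := ⟨hs.1, hs.2.le⟩
  refine ⟨?_, le_of_tendsto' (hlim s hs') fun n => hWU n s hs',
    fun μ hμ => ge_of_tendsto' (hlim s hs') fun n => hWΓ n s hs' μ hμ⟩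
  have hs2 : 0 < s / 2 := half_pos hs.1
  refine hasDerivAt_of_tendsto (b := T) hs2 (Gamma_pos hν hs2) ?_
    (fun t ht => hlim t ⟨hs2.trans_le ht.1, ht.2⟩) s ⟨half_lt_self hs.1, hs.2⟩
  filter_upwards [ha_lim.eventually_le_const hs2] with n hn
  have hpos := (hV n).mono hn
  refine ⟨fun t ht => ?_, fun t ht => (Gamma_mono hν hs2 ht.1).trans
    (hWΓ n t ⟨hs2.trans_le ht.1, ht.2⟩ ν hν)⟩
  rw [hWV n t (hn.trans ht.1)]
  exact ⟨(hpos t ht).1, (hpos t ht).2.congr (fun x hx => hWV n x (hn.trans hx.1))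
    (hWV n t (hn.trans ht.1))⟩

lemma lintegral_one_div_eq_top {T : ℝ} (hT : 0 < T) {v : ℝ → ℝ}
    (hpos : ∀ s ∈ Ioo 0 T, 0 < v s) (hle : ∀ s ∈ Ioo 0 T, v s ≤ upper s) :
    (∫⁻ s in Ioo 0 T, ENNReal.ofReal (1 / v s)) = ⊤ := by
  by_contra hne
  have hmono : (∫⁻ s in Ioo 0 T, ENNReal.ofReal (1 / upper s)) ≤
      ∫⁻ s in Ioo 0 T, ENNReal.ofReal (1 / v s) :=
    setLIntegral_mono' measurableSet_Ioo fun s hs =>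
      ENNReal.ofReal_le_ofReal (one_div_le_one_div_of_le (hpos s hs) (hle s hs))
  have hmeas : Measurable fun s => 1 / upper s := by
    unfold upper
    fun_prop
  have hint : IntegrableOn (fun s => 1 / upper s) (Ioo 0 T) := by
    refine ⟨hmeas.aestronglyMeasurable, ?_⟩
    rw [hasFiniteIntegral_iff_ofReal]
    · exact hmono.trans_lt (lt_top_iff_ne_top.2 hne)
    · exact (ae_restrict_mem measurableSet_Ioo).mono fun s hs =>
        (one_div_pos.2 (upper_pos hs.1)).le
  have hint' : IntegrableOn (fun s : ℝ => s ^ (-(3:ℝ)/2)) (Ioo 0 T) := by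
    refine IntegrableOn.congr_fun (hint.const_mul (Real.sqrt 2)) (fun s hs => ?_) measurableSet_Ioo
    have := sqrt_two_pos.ne'
    simp only [upper]
    rw [neg_div, Real.rpow_neg hs.1.le]
    field_simp
  rw [intervalIntegral.integrableOn_Ioo_rpow_iff hT] at hint'
  norm_num at hint'

lemma tendsto_upper : Tendsto upper (𝓝[>] 0) (𝓝 0) := by
  have h : Continuous upper := by
    unfold upper
    exact continuous_const.mul (Real.continuous_rpow_const (by norm_num))
  have h0 : upper 0 = 0 := by simp [upper]
  simpa only [h0] using (h.tendsto 0).mono_left (nhdsWithin_le_nhds (s := Ioi 0))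

lemma tendsto_div_rpow {T : ℝ} (hT : 0 < T) {v : ℝ → ℝ}
    (hle : ∀ s ∈ Ioo 0 T, v s ≤ upper s)
    (hge : ∀ s ∈ Ioo 0 T, ∀ μ ∈ Ioo 0 (Real.sqrt 2), Gamma μ s ≤ v s) :
    Tendsto (fun s => v s / s ^ ((3:ℝ)/2)) (𝓝[>] 0) (𝓝 (Real.sqrt 2)) := by
  refine tendsto_order.2 ⟨fun c hc => ?_, fun c hc => ?_⟩
  · obtain ⟨μ, hμ0, hμ⟩ : ∃ μ, 0 < μ ∧ μ < min (Real.sqrt 2) (Real.sqrt 2 - c) :=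
      exists_between (lt_min sqrt_two_pos (sub_pos.2 hc))
    have hμ' : μ ∈ Ioo 0 (Real.sqrt 2) := ⟨hμ0, hμ.trans_le (min_le_left _ _)⟩
    have hδ : 0 < μ / (3 * Real.sqrt 2) := div_pos hμ0 (mul_pos three_pos sqrt_two_pos)
    filter_upwards [Ioo_mem_nhdsGT hT, Ioo_mem_nhdsGT hδ] with s hs hsδ
    have hp := Real.rpow_pos_of_pos hs.1 ((3:ℝ)/2)
    have h := hge s hs μ hμ'
    rw [Gamma, if_pos hsδ.2.le, ← le_div_iff₀ hp] at h
    have := hμ.trans_le (min_le_right _ _)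
    linarith
  · filter_upwards [Ioo_mem_nhdsGT hT] with s hs
    exact ((div_le_iff₀ (Real.rpow_pos_of_pos hs.1 _)).2 (hle s hs)).trans_lt hc

end SingularODE

/-- Existence of a solution `ṽ` of the singular problem
`ṽ'(s) = s/ṽ(s) - 1/√(2s)` on `(0, s₀)` with `ṽ > 0`, `ṽ(0⁺) = 0`,
`∫₀^{s₀} ds/ṽ(s) = +∞`, the two-sided bound `Γ_μ ≤ ṽ ≤ √2 s^{3/2}` for all `μ ∈ (0, √2)`,
and the asymptotics `ṽ(s)/s^{3/2} → √2` as `s → 0⁺`. -/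
theorem stmt_4 (s₀ : ℝ) (hs₀ : 0 < s₀) :
    ∃ v : ℝ → ℝ,
      (∀ s ∈ Set.Ioo 0 s₀, 0 < v s) ∧
      (∀ s ∈ Set.Ioo 0 s₀, HasDerivAt v (s / v s - 1 / Real.sqrt (2 * s)) s) ∧
      Filter.Tendsto v (nhdsWithin 0 (Set.Ioi 0)) (nhds 0) ∧
      (∫⁻ s in Set.Ioo 0 s₀, ENNReal.ofReal (1 / v s)) = ⊤ ∧
      (∀ μ ∈ Set.Ioo 0 (Real.sqrt 2), ∀ s ∈ Set.Ioo 0 s₀,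
        Gamma μ s ≤ v s ∧ v s ≤ Real.sqrt 2 * s ^ ((3:ℝ)/2)) ∧
      Filter.Tendsto (fun s => v s / s ^ ((3:ℝ)/2)) (nhdsWithin 0 (Set.Ioi 0))
        (nhds (Real.sqrt 2)) := by
  obtain ⟨v, hv⟩ := SingularODE.exists_solution_between hs₀
  obtain ⟨ν, hν⟩ : (Set.Ioo 0 (Real.sqrt 2)).Nonempty := Set.nonempty_Ioo.2 SingularODE.sqrt_two_pos
  have hpos : ∀ s ∈ Set.Ioo 0 s₀, 0 < v s := fun s hs =>
    (SingularODE.Gamma_pos hν hs.1).trans_le ((hv s hs).2.2 ν hν)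
  have hle : ∀ s ∈ Set.Ioo 0 s₀, v s ≤ SingularODE.upper s := fun s hs => (hv s hs).2.1
  have hnear := Ioo_mem_nhdsGT hs₀
  exact ⟨v, hpos, fun s hs => (hv s hs).1,
    squeeze_zero' (Filter.eventually_of_mem hnear fun s hs => (hpos s hs).le)
      (Filter.eventually_of_mem hnear hle) SingularODE.tendsto_upper,
    SingularODE.lintegral_one_div_eq_top hs₀ hpos hle,
    fun μ hμ s hs => ⟨(hv s hs).2.2 μ hμ, hle s hs⟩,
    SingularODE.tendsto_div_rpow hs₀ hle fun s hs => (hv s hs).2.2⟩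
end

section
/- For every s₀ ∈ (0, 1/6) there exists a twice differentiable function q̄ : (0, ∞) → ℝ such that −s₀ < q̄(x) < 0 and −q̄''(x) + q̄(x) + q̄'(x)/√(−2 q̄(x)) = 0 for all x > 0, lim_{x→0⁺} q̄(x) = −s₀, lim_{x→∞} q̄(x) = 0, and for all x > 0: −(s₀^{−1/2} + x/(2√2))^{−2} ≤ q̄(x) ≤ −(s₀^{−1/2} + x/√2)^{−2} and (√2/2)·(s₀^{−1/2} + x/√2)^{−3} ≤ q̄'(x) ≤ √2·(s₀^{−1/2} + x/(2√2))^{−3}. -/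
open Set Filter Topology MeasureTheory

noncomputable section

namespace RadiatingGas

/-! ### The bounded solution of `y' = a y - k` -/

/-- For bounded continuous `k` and `0 < a`, the bounded solution of `y' = a * y - k`. -/
def discountedTail (a : ℝ) (k : ℝ → ℝ) (t : ℝ) : ℝ :=
  Real.exp (a * t) * ∫ τ in Ioi t, Real.exp (-a * τ) * k τ

variable {a C : ℝ} {k l : ℝ → ℝ}

theorem integrableOn_exp_neg_mul (ha : 0 < a) (hk : Continuous k) (hC : ∀ t, |k t| ≤ C) (t : ℝ) :
    IntegrableOn (fun τ => Real.exp (-a * τ) * k τ) (Ioi t) := by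
  refine Integrable.mul_bdd (c := C) (integrableOn_exp_mul_Ioi (neg_neg_of_pos ha) t)
    hk.aestronglyMeasurable ?_
  exact ae_of_all _ fun x => hC x

theorem hasDerivAt_discountedTail (ha : 0 < a) (hk : Continuous k) (hC : ∀ t, |k t| ≤ C) (t : ℝ) :
    HasDerivAt (discountedTail a k) (a * discountedTail a k t - k t) t := by
  have hcont : Continuous fun τ => Real.exp (-a * τ) * k τ := by fun_prop
  have heq : discountedTail a k = fun t => Real.exp (a * t) *
      ((∫ τ in Ioi 0, Real.exp (-a * τ) * k τ) - ∫ τ in (0 : ℝ)..t, Real.exp (-a * τ) * k τ) := by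
    funext s
    rw [discountedTail, ← intervalIntegral.integral_Ioi_sub_Ioi'
      (integrableOn_exp_neg_mul ha hk hC 0) (integrableOn_exp_neg_mul ha hk hC s), sub_sub_cancel]
  have h1 : HasDerivAt (fun t => Real.exp (a * t)) (Real.exp (a * t) * (a * 1)) t :=
    ((hasDerivAt_id t).const_mul a).exp
  have h2 := (hcont.integral_hasStrictDerivAt 0 t).hasDerivAt.const_sub
    (∫ τ in Ioi 0, Real.exp (-a * τ) * k τ)
  have h3 := h1.mul h2
  have hexp : Real.exp (a * t) * Real.exp (-a * t) = 1 := by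
    rw [← Real.exp_add]; simp
  rw [heq]
  refine h3.congr_deriv ?_
  linear_combination (-k t) * hexp

theorem discountedTail_const (ha : 0 < a) (c t : ℝ) :
    discountedTail a (fun _ => c) t = c / a := by
  have hexp : Real.exp (a * t) * Real.exp (-a * t) = 1 := by
    rw [← Real.exp_add]; simp
  rw [discountedTail, integral_mul_const, integral_exp_mul_Ioi (neg_neg_of_pos ha)]
  rw [neg_div_neg_eq, ← mul_assoc, ← mul_div_assoc, hexp, one_div_mul_eq_div]

theorem discountedTail_mono (ha : 0 < a) (hk : Continuous k) (hC : ∀ t, |k t| ≤ C)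
    {C' : ℝ} (hl : Continuous l) (hC' : ∀ t, |l t| ≤ C') (hkl : ∀ t, k t ≤ l t) (t : ℝ) :
    discountedTail a k t ≤ discountedTail a l t := by
  refine mul_le_mul_of_nonneg_left ?_ (Real.exp_pos _).le
  refine integral_mono (integrableOn_exp_neg_mul ha hk hC t)
    (integrableOn_exp_neg_mul ha hl hC' t) fun τ => ?_
  exact mul_le_mul_of_nonneg_left (hkl τ) (Real.exp_pos _).le

theorem discountedTail_sub (ha : 0 < a) (hk : Continuous k) (hC : ∀ t, |k t| ≤ C)
    {C' : ℝ} (hl : Continuous l) (hC' : ∀ t, |l t| ≤ C') (t : ℝ) :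
    discountedTail a (fun τ => k τ - l τ) t = discountedTail a k t - discountedTail a l t := by
  simp only [discountedTail, mul_sub]
  rw [integral_sub (integrableOn_exp_neg_mul ha hk hC t) (integrableOn_exp_neg_mul ha hl hC' t),
    mul_sub]

theorem discountedTail_mem_Icc (ha : 0 < a) (hk : Continuous k) {m M : ℝ}
    (h : ∀ t, k t ∈ Icc m M) (t : ℝ) : discountedTail a k t ∈ Icc (m / a) (M / a) := by
  have hb : ∀ t, |k t| ≤ max |m| |M| := fun t => abs_le_max_abs_abs (h t).1 (h t).2
  rw [← discountedTail_const ha m t, ← discountedTail_const ha M t]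
  exact ⟨discountedTail_mono ha continuous_const (fun _ => le_rfl) hk hb (fun t => (h t).1) t,
    discountedTail_mono ha hk hb continuous_const (fun _ => le_rfl) (fun t => (h t).2) t⟩

/-! ### The normalized slope equation -/

/-- Truncation to the interval `[1/2, 1]`. -/
def clamp (u : ℝ) : ℝ := max (1 / 2) (min 1 u)

theorem clamp_mem (u : ℝ) : clamp u ∈ Icc (1 / 2 : ℝ) 1 :=
  ⟨le_max_left _ _, max_le (by norm_num) (min_le_left _ _)⟩

theorem clamp_of_mem {u : ℝ} (hu : u ∈ Icc (1 / 2 : ℝ) 1) : clamp u = u := by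
  rw [clamp, min_eq_right hu.2, max_eq_right hu.1]

theorem abs_clamp_sub_le (u v : ℝ) : |clamp u - clamp v| ≤ |u - v| :=
  by
  unfold clamp
  have h1 := abs_max_sub_max_le_max (1 / 2) (min 1 u) (1 / 2) (min 1 v)
  have h2 := abs_min_sub_min_le_max 1 u 1 v
  simp only [sub_self, abs_zero, abs_nonneg, sup_of_le_right] at h1 h2
  exact h1.trans h2

theorem continuous_clamp : Continuous clamp := by unfold clamp; fun_prop

/-- The truncation of `5 * u - (1 - 1 / u + 3 * u / (2 * t))` to `u ∈ [1/2, 1]` and `3 ≤ t`. -/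
def source (t u : ℝ) : ℝ :=
  5 * clamp u - 1 + 1 / clamp u - 3 / (2 * max t 3) * clamp u

theorem coeff_mem (t : ℝ) : 3 / (2 * max t 3) ∈ Icc (0 : ℝ) (1 / 2) := by
  have h : (3 : ℝ) ≤ max t 3 := le_max_right _ _
  refine ⟨by positivity, ?_⟩
  rw [div_le_div_iff₀ (by linarith) (by norm_num)]
  linarith

theorem source_mem (t u : ℝ) : source t u ∈ Icc (5 / 2 : ℝ) 5 := by
  obtain ⟨hb0, hb1⟩ := coeff_mem t
  obtain ⟨h0, h1⟩ := clamp_mem u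
  unfold source
  set b := 3 / (2 * max t 3)
  set c := clamp u
  have hc : 0 < c := by linarith
  have hinv : 1 / c * c = 1 := by field_simp
  have hi1 : 1 / c ≤ 2 := by rw [div_le_iff₀ hc]; linarith
  have hi0 : 2 - c ≤ 1 / c := by rw [le_div_iff₀ hc]; nlinarith [sq_nonneg (c - 1)]
  constructor <;> nlinarith

theorem abs_source_sub_le (t u v : ℝ) : |source t u - source t v| ≤ 4 * |u - v| := by
  obtain ⟨hb0, hb1⟩ := coeff_mem t
  obtain ⟨hc0, hc1⟩ := clamp_mem u
  obtain ⟨hd0, hd1⟩ := clamp_mem v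
  have hle := abs_clamp_sub_le u v
  unfold source
  set b := 3 / (2 * max t 3)
  set c := clamp u
  set d := clamp v
  have hc : 0 < c := by linarith
  have hd : 0 < d := by linarith
  have hcd : 1 / (c * d) ∈ Icc (1 : ℝ) 4 := by
    rw [mem_Icc, le_div_iff₀ (by positivity), div_le_iff₀ (by positivity)]
    constructor <;> nlinarith
  have hfac : 5 * c - 1 + 1 / c - b * c - (5 * d - 1 + 1 / d - b * d)
      = (5 - b - 1 / (c * d)) * (c - d) := by
    field_simp
    ring
  rw [hfac, abs_mul]
  refine mul_le_mul ?_ hle (abs_nonneg _) (by norm_num)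
  rw [abs_le]
  constructor <;> linarith [hcd.1, hcd.2]

theorem continuous_source {u : ℝ → ℝ} (hu : Continuous u) : Continuous fun t => source t (u t) := by
  have hc : Continuous fun t => clamp (u t) := continuous_clamp.comp hu
  have h0 : ∀ t, clamp (u t) ≠ 0 := fun t => by linarith [(clamp_mem (u t)).1]
  have h1 : ∀ t : ℝ, 2 * max t 3 ≠ 0 := fun t => by
    have : (3 : ℝ) ≤ max t 3 := le_max_right _ _
    positivity
  unfold source
  fun_prop (disch := assumption)

theorem abs_source_le (t u : ℝ) : |source t u| ≤ 5 := by
  rw [abs_le]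
  constructor <;> linarith [(source_mem t u).1, (source_mem t u).2]

/-- The Lyapunov–Perron operator of the truncated slope equation. -/
def perronOperator (u : BoundedContinuousFunction ℝ ℝ) : BoundedContinuousFunction ℝ ℝ :=
  BoundedContinuousFunction.ofNormedAddCommGroup
    (discountedTail 5 fun t => source t (u t))
    (continuous_iff_continuousAt.2 fun t => (hasDerivAt_discountedTail (by norm_num)
      (continuous_source u.continuous) (fun t => abs_source_le t (u t)) t).continuousAt)
    1 (fun t => by
      have h := discountedTail_mem_Icc (a := 5) (by norm_num) (continuous_source u.continuous)
        (fun t => source_mem t (u t)) t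
      rw [Real.norm_eq_abs, abs_le]
      constructor <;> linarith [h.1, h.2])

theorem contractingWith_perronOperator : ContractingWith (4 / 5) perronOperator := by
  have h45 : ((4 / 5 : NNReal) : ℝ) = 4 / 5 := by norm_num
  refine ⟨by rw [← NNReal.coe_lt_coe, h45]; norm_num, LipschitzWith.of_dist_le_mul fun u v => ?_⟩
  rw [h45, BoundedContinuousFunction.dist_le (by positivity)]
  intro t
  have hu := continuous_source u.continuous
  have hv := continuous_source v.continuous
  have hsub := discountedTail_sub (a := 5) (by norm_num) hu (fun t => abs_source_le t (u t))
    hv (fun t => abs_source_le t (v t)) t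
  have hmem := discountedTail_mem_Icc (a := 5) (k := fun s => source s (u s) - source s (v s))
    (by norm_num) (hu.sub hv)
    (m := -(4 * dist u v)) (M := 4 * dist u v) (fun s => by
      rw [mem_Icc, ← abs_le]
      refine (abs_source_sub_le s (u s) (v s)).trans ?_
      have := BoundedContinuousFunction.dist_coe_le_dist (f := u) (g := v) s
      rw [Real.dist_eq] at this
      linarith) t
  change |discountedTail 5 _ t - discountedTail 5 _ t| ≤ _
  rw [← hsub, abs_le]
  constructor <;> linarith [hmem.1, hmem.2]

/-- The degenerate slope equation has a solution confined to `[1/2, 1]`. -/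
theorem exists_slope : ∃ ζ : ℝ → ℝ, Continuous ζ ∧ (∀ t, ζ t ∈ Icc (1 / 2 : ℝ) 1) ∧
    ∀ t, 3 ≤ t → HasDerivAt ζ (1 - 1 / ζ t + 3 / (2 * t) * ζ t) t := by
  obtain ⟨u, hu, -⟩ := contractingWith_perronOperator.exists_fixedPoint 0 (edist_ne_top _ _)
  have hfun : (u : ℝ → ℝ) = discountedTail 5 fun t => source t (u t) :=
    (congrArg (fun w : BoundedContinuousFunction ℝ ℝ => (w : ℝ → ℝ)) hu.eq).symm
  have hmem : ∀ t, u t ∈ Icc (1 / 2 : ℝ) 1 := fun t => by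
    have h := discountedTail_mem_Icc (a := 5) (by norm_num) (continuous_source u.continuous)
        (fun t => source_mem t (u t)) t
    rw [← hfun] at h
    constructor <;> linarith [h.1, h.2]
  refine ⟨u, u.continuous, hmem, fun t ht => ?_⟩
  have h := hasDerivAt_discountedTail (a := 5) (by norm_num) (continuous_source u.continuous)
    (fun t => abs_source_le t (u t)) t
  rw [← hfun] at h
  refine h.congr_deriv ?_
  rw [source, clamp_of_mem (hmem t), max_eq_left ht]
  ring

/-! ### Reconstruction of the profile -/

/-- A scalar autonomous equation with continuous right-hand side in `[1/2, 1]` has a global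
solution, and its growth rate is controlled accordingly. -/
theorem exists_autonomous_solution {f : ℝ → ℝ} (hf : Continuous f)
    (hmem : ∀ w, f w ∈ Icc (1 / 2 : ℝ) 1) (w₀ : ℝ) :
    ∃ W : ℝ → ℝ, W 0 = w₀ ∧ (∀ ξ, HasDerivAt W (f (W ξ)) ξ) ∧
      ∀ ξ, 0 ≤ ξ → W ξ ∈ Icc (w₀ + ξ / 2) (w₀ + ξ) := by
  have hpos : ∀ w, 0 < f w := fun w => by linarith [(hmem w).1]
  have hinv : Continuous fun w => 1 / f w := continuous_const.div hf fun w => (hpos w).ne'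
  let X : ℝ → ℝ := fun w => ∫ v in w₀..w, 1 / f v
  have hX : ∀ w, HasDerivAt X (1 / f w) w := fun w =>
    (hinv.integral_hasStrictDerivAt w₀ w).hasDerivAt
  have hXd : Differentiable ℝ X := fun w => (hX w).differentiableAt
  have hmono : StrictMono X := strictMono_of_deriv_pos fun w => by
    rw [(hX w).deriv]; exact one_div_pos.2 (hpos w)
  have hX0 : X w₀ = 0 := intervalIntegral.integral_same
  have hgrow : ∀ ⦃x y : ℝ⦄, x ≤ y → 1 * (y - x) ≤ X y - X x :=
    mul_sub_le_image_sub_of_le_deriv hXd fun w => by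
      rw [(hX w).deriv, le_div_iff₀ (hpos w)]; linarith [(hmem w).2]
  have hsurj : Function.Surjective X := by
    refine hXd.continuous.surjective ?_ ?_
    · refine tendsto_atTop_mono' atTop ?_ (tendsto_atTop_add_const_right _ (-w₀) tendsto_id)
      filter_upwards [eventually_ge_atTop w₀] with w hw
      have := hgrow hw
      simp only [id]
      linarith
    · refine tendsto_atBot_mono' atBot ?_ (tendsto_atBot_add_const_right _ (-w₀) tendsto_id)
      filter_upwards [eventually_le_atBot w₀] with w hw
      have := hgrow hw
      simp only [id]
      linarith
  let e := hmono.orderIsoOfSurjective X hsurj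
  have hXe : ∀ ξ, X (e.symm ξ) = ξ := fun ξ => e.apply_symm_apply ξ
  have he0 : e.symm 0 = w₀ := by
    apply hmono.injective
    rw [hXe, hX0]
  have hW : ∀ ξ, HasDerivAt e.symm (f (e.symm ξ)) ξ := fun ξ => by
    have := HasDerivAt.of_local_left_inverse e.symm.continuous.continuousAt (hX (e.symm ξ))
      (one_div_pos.2 (hpos _)).ne' (Eventually.of_forall hXe)
    simpa using this
  have hWd : Differentiable ℝ e.symm := fun ξ => (hW ξ).differentiableAt
  refine ⟨e.symm, he0, hW, fun ξ hξ => ?_⟩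
  have h1 := mul_sub_le_image_sub_of_le_deriv hWd (C := 1 / 2)
    (fun ξ => by rw [(hW ξ).deriv]; exact (hmem _).1) hξ
  have h2 := image_sub_le_mul_sub_of_deriv_le hWd (C := 1)
    (fun ξ => by rw [(hW ξ).deriv]; exact (hmem _).2) hξ
  rw [he0] at h1 h2
  constructor <;> linarith

end RadiatingGas

end


/-- Existence of the stationary solution `q̄` of the degenerate problem
`-q̄'' + q̄ + q̄'/√(-2q̄) = 0` on `(0, ∞)` with `q̄(0⁺) = -s₀`, `q̄(+∞) = 0`, together with
the algebraic decay estimates for `q̄` and `q̄'`. -/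
theorem stmt_5 (s₀ : ℝ) (hs₀ : s₀ ∈ Set.Ioo 0 (1/6 : ℝ)) :
    ∃ q : ℝ → ℝ,
      (∀ x ∈ Set.Ioi (0:ℝ), DifferentiableAt ℝ q x ∧ DifferentiableAt ℝ (deriv q) x) ∧
      (∀ x ∈ Set.Ioi (0:ℝ), -s₀ < q x ∧ q x < 0) ∧
      (∀ x ∈ Set.Ioi (0:ℝ),
        -(deriv (deriv q) x) + q x + deriv q x / Real.sqrt (-(2 * q x)) = 0) ∧
      Filter.Tendsto q (nhdsWithin 0 (Set.Ioi 0)) (nhds (-s₀)) ∧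
      Filter.Tendsto q Filter.atTop (nhds 0) ∧
      (∀ x ∈ Set.Ioi (0:ℝ),
        -(1 / (1 / Real.sqrt s₀ + x / (2 * Real.sqrt 2)) ^ 2) ≤ q x ∧
        q x ≤ -(1 / (1 / Real.sqrt s₀ + x / Real.sqrt 2) ^ 2)) ∧
      (∀ x ∈ Set.Ioi (0:ℝ),
        Real.sqrt 2 / 2 / (1 / Real.sqrt s₀ + x / Real.sqrt 2) ^ 3 ≤ deriv q x ∧
        deriv q x ≤ Real.sqrt 2 / (1 / Real.sqrt s₀ + x / (2 * Real.sqrt 2)) ^ 3) := by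
  obtain ⟨hs0, hs1⟩ := hs₀
  obtain ⟨ζ, hζc, hζ, hζd⟩ := RadiatingGas.exists_slope
  obtain ⟨W, hW0, hW, hWb⟩ := RadiatingGas.exists_autonomous_solution
    (f := fun w => ζ (w ^ 2 / 2)) (by fun_prop) (fun w => hζ _) (1 / √s₀)
  set w₀ := 1 / √s₀ with hw₀
  have hr0 : 0 < √(2 : ℝ) := by positivity
  have hr2 : √(2 : ℝ) ^ 2 = 2 := Real.sq_sqrt (by norm_num)
  have hw0 : 0 < w₀ := by positivity
  have hs₀w : s₀ = 1 / w₀ ^ 2 := by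
    rw [hw₀, one_div_pow, Real.sq_sqrt hs0.le, one_div_one_div]
  have hw6 : 6 < w₀ ^ 2 := by
    rw [hs₀w, one_div_lt_one_div (by positivity) (by norm_num)] at hs1
    exact hs1
  let V : ℝ → ℝ := fun x => W (x / √2)
  let S : ℝ → ℝ := fun x => ζ (V x ^ 2 / 2)
  have hVd : ∀ x, HasDerivAt V (S x / √2) x := fun x =>
    ((hW (x / √2)).comp x ((hasDerivAt_id x).div_const √2)).congr_deriv (by simp [S, V]; ring)
  have hVb : ∀ x, 0 ≤ x → V x ∈ Set.Icc (w₀ + x / (2 * √2)) (w₀ + x / √2) := fun x hx => by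
    have h := hWb (x / √2) (by positivity)
    rwa [show x / √2 / 2 = x / (2 * √2) by ring] at h
  have hVge : ∀ x, 0 ≤ x → w₀ ≤ V x := fun x hx =>
    (le_add_of_nonneg_right (by positivity)).trans (hVb x hx).1
  have hVgt : ∀ x, 0 < x → w₀ < V x := fun x hx =>
    (lt_add_of_pos_right _ (by positivity)).trans_le (hVb x hx.le).1
  have hVpos : ∀ x, 0 ≤ x → 0 < V x := fun x hx => hw0.trans_le (hVge x hx)
  have hS : ∀ x, S x ∈ Set.Icc (1 / 2 : ℝ) 1 := fun x => hζ _
  have hSd : ∀ x, 0 ≤ x → HasDerivAt S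
      ((1 - 1 / S x + 3 / V x ^ 2 * S x) * (V x * S x / √2)) x := fun x hx => by
    have h3 : 3 ≤ V x ^ 2 / 2 := by nlinarith [hVge x hx]
    refine ((hζd _ h3).comp x (((hVd x).pow 2).div_const 2)).congr_deriv ?_
    rw [show 2 * (V x ^ 2 / 2) = V x ^ 2 by ring]
    simp only [S]
    push_cast
    ring
  have hqd : ∀ x, 0 ≤ x → HasDerivAt (fun x => -(1 / V x ^ 2)) (√2 * S x / V x ^ 3) x :=
    fun x hx => by
      have hV := (hVpos x hx).ne'
      have h := (((hVd x).pow 2).inv (pow_ne_zero 2 hV)).neg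
      simp only [one_div]
      refine h.congr_deriv ?_
      simp only [Pi.pow_apply]
      push_cast
      field_simp
      linear_combination -S x * hr2
  have hqd2 : ∀ x, 0 < x → HasDerivAt (deriv fun x => -(1 / V x ^ 2)) ((S x - 1) / V x ^ 2) x :=
    fun x hx => by
      have hV := (hVpos x hx.le).ne'
      have hS0 : S x ≠ 0 := by linarith [(hS x).1]
      have h := (((hSd x hx.le).const_mul √2).div ((hVd x).pow 3) (pow_ne_zero 3 hV))
      refine HasDerivAt.congr_of_eventuallyEq (h.congr_deriv ?_) ?_
      · simp only [Pi.pow_apply]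
        push_cast
        field_simp
        ring
      · filter_upwards [Ioi_mem_nhds hx] with y hy
        exact (hqd y (le_of_lt hy)).deriv
  have hbound : ∀ x ∈ Set.Ioi (0 : ℝ),
      -(1 / (w₀ + x / (2 * √2)) ^ 2) ≤ -(1 / V x ^ 2) ∧
      -(1 / V x ^ 2) ≤ -(1 / (w₀ + x / √2) ^ 2) := fun x (hx : 0 < x) => by
    have hV := hVpos x hx.le
    obtain ⟨h1, h2⟩ := hVb x hx.le
    constructor <;> gcongr
  refine ⟨fun x => -(1 / V x ^ 2), fun x (hx : 0 < x) => ⟨(hqd x hx.le).differentiableAt,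
    (hqd2 x hx).differentiableAt⟩, fun x (hx : 0 < x) => ⟨?_, ?_⟩, fun x (hx : 0 < x) => ?_,
    ?_, ?_, hbound, fun x (hx : 0 < x) => ?_⟩
  · have := hVgt x hx
    change -s₀ < -(1 / V x ^ 2)
    rw [hs₀w]
    gcongr
  · have := hVpos x hx.le
    exact neg_neg_of_pos (by positivity)
  · have hV := hVpos x hx.le
    have hsqrt : √(-(2 * -(1 / V x ^ 2))) = √2 / V x := by
      rw [show -(2 * -(1 / V x ^ 2)) = 2 / V x ^ 2 by ring, Real.sqrt_div (by norm_num),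
        Real.sqrt_sq hV.le]
    rw [(hqd2 x hx).deriv, (hqd x hx.le).deriv, hsqrt]
    field_simp
    ring
  · have h := (hqd 0 le_rfl).continuousAt.tendsto
    rw [show V 0 = w₀ by simp [V, hW0], ← hs₀w] at h
    exact h.mono_left nhdsWithin_le_nhds
  · have hlin : Filter.Tendsto (fun x : ℝ => w₀ + x / (2 * √2)) Filter.atTop Filter.atTop :=
      Filter.tendsto_atTop_add_const_left _ _ (Filter.tendsto_id.atTop_div_const (by positivity))
    have hlow := ((Filter.tendsto_pow_atTop two_ne_zero).comp hlin).inv_tendsto_atTop.neg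
    rw [neg_zero] at hlow
    refine tendsto_of_tendsto_of_tendsto_of_le_of_le' hlow tendsto_const_nhds ?_ ?_
    · filter_upwards [Filter.eventually_gt_atTop 0] with x hx
      simpa using (hbound x hx).1
    · filter_upwards [Filter.eventually_gt_atTop 0] with x hx
      have := hVpos x hx.le
      exact neg_nonpos_of_nonneg (by positivity)
  · rw [(hqd x hx.le).deriv]
    have hV := hVpos x hx.le
    obtain ⟨h1, h2⟩ := hVb x hx.le
    obtain ⟨h3, h4⟩ := hS x
    constructor
    · gcongr
      linarith [mul_le_mul_of_nonneg_left h3 hr0.le]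
    · gcongr
      exact mul_le_of_le_one_right hr0.le h4
end

section
/- Let s₀ ∈ (0, 1/8] and let ṽ : (0, s₀) → ℝ be differentiable with ṽ(s) > 0 and ṽ'(s) = s/ṽ(s) − 1/√(2s) for all s ∈ (0, s₀), and suppose Γ_μ(s) ≤ ṽ(s) ≤ √2 · s^{3/2} for every μ ∈ (0, √2) and every s ∈ (0, s₀). Then √2 s^{3/2} − 3√2 s^{5/2} + 24√2 s^{7/2} − 285√2 s^{9/2} ≤ ṽ(s) ≤ √2 s^{3/2} − 3√2 s^{5/2} + 24√2 s^{7/2} for all s ∈ (0, s₀). -/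
open Filter Topology in
/-- A function tending to `0` at `0⁺` whose derivative is negative wherever it is positive
is nonpositive. -/
lemma nonpos_of_tendsto_zero_of_deriv_neg {f f' : ℝ → ℝ} {b : ℝ}
    (hf : ∀ s ∈ Set.Ioo 0 b, HasDerivAt f (f' s) s)
    (hneg : ∀ s ∈ Set.Ioo 0 b, 0 < f s → f' s < 0)
    (hlim : Tendsto f (𝓝[>] 0) (𝓝 0)) {s : ℝ} (hs : s ∈ Set.Ioo 0 b) : f s ≤ 0 := by
  refine le_of_forall_pos_le_add fun ε hε => ?_
  obtain ⟨t, htε, ht0, hts⟩ :=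
    ((hlim.eventually (gt_mem_nhds hε)).and (Ioo_mem_nhdsGT hs.1)).exists
  have hmem : ∀ x ∈ Set.Icc t s, x ∈ Set.Ioo 0 b := fun x hx =>
    ⟨ht0.trans_le hx.1, hx.2.trans_lt hs.2⟩
  have hle : f s ≤ ε := image_le_of_deriv_right_lt_deriv_boundary'
    (B := fun _ => ε) (B' := fun _ => 0)
    (fun x hx => (hf x (hmem x hx)).continuousAt.continuousWithinAt)
    (fun x hx => (hf x (hmem x (Set.Ico_subset_Icc_self hx))).hasDerivWithinAt)
    htε.le continuousOn_const (fun x _ => hasDerivWithinAt_const x _ ε)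
    (fun x hx hxε => hneg x (hmem x (Set.Ico_subset_Icc_self hx)) (by rw [hxε]; exact hε))
    (Set.right_mem_Icc.2 hts.le)
  linarith

/-- The function `√2 s^{3/2} P(s)`. -/
noncomputable def barrier (P : ℝ → ℝ) (s : ℝ) : ℝ := Real.sqrt 2 * (s * Real.sqrt s) * P s

lemma hasDerivAt_barrier {P : ℝ → ℝ} {p' s : ℝ} (hs : 0 < s) (hP : HasDerivAt P p' s) :
    HasDerivAt (barrier P) (Real.sqrt 2 * Real.sqrt s * (3 / 2 * P s + s * p')) s := by
  have h := (((hasDerivAt_id s).mul (Real.hasDerivAt_sqrt hs.ne')).const_mul (Real.sqrt 2)).mul hP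
  refine h.congr_deriv ?_
  have hr : 0 < Real.sqrt s := Real.sqrt_pos.2 hs
  have hsq : Real.sqrt s ^ 2 = s := Real.sq_sqrt hs.le
  simp only [id, Pi.mul_apply]
  field_simp
  rw [hsq]
  ring

open Filter Topology in
lemma tendsto_barrier_zero {P : ℝ → ℝ} (hP : Continuous P) :
    Tendsto (barrier P) (𝓝[>] 0) (𝓝 0) := by
  have h : Continuous (barrier P) := by unfold barrier; fun_prop
  simpa [barrier] using (h.tendsto 0).mono_left nhdsWithin_le_nhds

/-- The defect of `barrier P` in the ODE, in terms of `P`. -/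
lemma barrier_defect {s p p' : ℝ} (hs : 0 < s) (hp : 0 < p) :
    Real.sqrt 2 * Real.sqrt s * (3 / 2 * p + s * p')
        - (s / (Real.sqrt 2 * (s * Real.sqrt s) * p) - 1 / Real.sqrt (2 * s))
      = (s * p * (3 * p + 2 * s * p') - (1 - p)) / (Real.sqrt 2 * Real.sqrt s * p) := by
  have hr : 0 < Real.sqrt s := Real.sqrt_pos.2 hs
  have h2 : 0 < Real.sqrt 2 := by positivity
  have hsq : Real.sqrt s ^ 2 = s := Real.sq_sqrt hs.le
  have h2q : Real.sqrt 2 ^ 2 = 2 := Real.sq_sqrt (by norm_num)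
  rw [Real.sqrt_mul (by norm_num)]
  field_simp
  rw [hsq, h2q]
  ring

open Filter Topology in
/-- Comparison with a supersolution `√2 s^{3/2} P(s)`. -/
lemma le_barrier {v P P' : ℝ → ℝ} {b : ℝ}
    (hode : ∀ s ∈ Set.Ioo 0 b, HasDerivAt v (s / v s - 1 / Real.sqrt (2 * s)) s)
    (hlim : Tendsto v (𝓝[>] 0) (𝓝 0)) (hP : ∀ s, HasDerivAt P (P' s) s)
    (hPpos : ∀ s ∈ Set.Ioo 0 b, 0 < P s)
    (hsup : ∀ s ∈ Set.Ioo 0 b, 1 - P s ≤ s * P s * (3 * P s + 2 * s * P' s))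
    {s : ℝ} (hs : s ∈ Set.Ioo 0 b) : v s ≤ barrier P s := by
  have hcont : Continuous P := continuous_iff_continuousAt.2 fun x => (hP x).continuousAt
  refine sub_nonpos.1 (nonpos_of_tendsto_zero_of_deriv_neg (f := fun x => v x - barrier P x)
    (fun x hx => (hode x hx).sub (hasDerivAt_barrier hx.1 (hP x))) (fun x hx hpos => ?_)
    (by simpa using hlim.sub (tendsto_barrier_zero hcont)) hs)
  have hx0 := hx.1
  have hp := hPpos x hx
  have hB : 0 < barrier P x := by unfold barrier; positivity
  have hlt : x / v x < x / barrier P x := div_lt_div_of_pos_left hx0 hB (sub_pos.1 hpos)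
  have hdef := barrier_defect (p' := P' x) hx0 hp
  have hnn : 0 ≤ (x * P x * (3 * P x + 2 * x * P' x) - (1 - P x))
      / (Real.sqrt 2 * Real.sqrt x * P x) :=
    div_nonneg (sub_nonneg.2 (hsup x hx)) (by positivity)
  unfold barrier at hlt
  linarith

open Filter Topology in
/-- Comparison with a subsolution `√2 s^{3/2} P(s)`. -/
lemma barrier_le {v P P' : ℝ → ℝ} {b : ℝ} (hv : ∀ s ∈ Set.Ioo 0 b, 0 < v s)
    (hode : ∀ s ∈ Set.Ioo 0 b, HasDerivAt v (s / v s - 1 / Real.sqrt (2 * s)) s)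
    (hlim : Tendsto v (𝓝[>] 0) (𝓝 0)) (hP : ∀ s, HasDerivAt P (P' s) s)
    (hPpos : ∀ s ∈ Set.Ioo 0 b, 0 < P s)
    (hsub : ∀ s ∈ Set.Ioo 0 b, s * P s * (3 * P s + 2 * s * P' s) ≤ 1 - P s)
    {s : ℝ} (hs : s ∈ Set.Ioo 0 b) : barrier P s ≤ v s := by
  have hcont : Continuous P := continuous_iff_continuousAt.2 fun x => (hP x).continuousAt
  refine sub_nonpos.1 (nonpos_of_tendsto_zero_of_deriv_neg (f := fun x => barrier P x - v x)
    (fun x hx => (hasDerivAt_barrier hx.1 (hP x)).sub (hode x hx)) (fun x hx hpos => ?_)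
    (by simpa using (tendsto_barrier_zero hcont).sub hlim) hs)
  have hx0 := hx.1
  have hp := hPpos x hx
  have hlt : x / barrier P x < x / v x := div_lt_div_of_pos_left hx0 (hv x hx) (sub_pos.1 hpos)
  have hdef := barrier_defect (p' := P' x) hx0 hp
  have hnn : (x * P x * (3 * P x + 2 * x * P' x) - (1 - P x))
      / (Real.sqrt 2 * Real.sqrt x * P x) ≤ 0 :=
    div_nonpos_of_nonpos_of_nonneg (sub_nonpos.2 (hsub x hx)) (by positivity)
  unfold barrier at hlt
  linarith

lemma rpow_add_half {s : ℝ} (hs : 0 < s) (n : ℕ) {a : ℝ} (ha : a = n + 1 / 2) :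
    s ^ a = s ^ n * Real.sqrt s := by
  rw [ha, Real.rpow_add hs, Real.rpow_natCast, Real.sqrt_eq_rpow]

/-- Third-order finite expansion of the solution `ṽ` of the singular ODE
`ṽ'(s) = s/ṽ(s) - 1/√(2s)`:
`√2 s^{3/2} - 3√2 s^{5/2} + 24√2 s^{7/2} - 285√2 s^{9/2} ≤ ṽ(s)
  ≤ √2 s^{3/2} - 3√2 s^{5/2} + 24√2 s^{7/2}`. -/
theorem stmt_7 (s₀ : ℝ) (hs₀ : s₀ ∈ Set.Ioc 0 (1/8 : ℝ)) (v : ℝ → ℝ)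
    (hpos : ∀ s ∈ Set.Ioo 0 s₀, 0 < v s)
    (hode : ∀ s ∈ Set.Ioo 0 s₀, HasDerivAt v (s / v s - 1 / Real.sqrt (2 * s)) s)
    (hbd : ∀ μ ∈ Set.Ioo 0 (Real.sqrt 2), ∀ s ∈ Set.Ioo 0 s₀,
      Gamma μ s ≤ v s ∧ v s ≤ Real.sqrt 2 * s ^ ((3:ℝ)/2)) :
    ∀ s ∈ Set.Ioo 0 s₀,
      Real.sqrt 2 * s ^ ((3:ℝ)/2) - 3 * Real.sqrt 2 * s ^ ((5:ℝ)/2)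
        + 24 * Real.sqrt 2 * s ^ ((7:ℝ)/2) - 285 * Real.sqrt 2 * s ^ ((9:ℝ)/2) ≤ v s ∧
      v s ≤ Real.sqrt 2 * s ^ ((3:ℝ)/2) - 3 * Real.sqrt 2 * s ^ ((5:ℝ)/2)
        + 24 * Real.sqrt 2 * s ^ ((7:ℝ)/2) := by
  obtain ⟨hs₀pos, hs₀le⟩ := hs₀
  have hlim : Filter.Tendsto v (nhdsWithin 0 (Set.Ioi 0)) (nhds 0) := by
    have hμ : Real.sqrt 2 / 2 ∈ Set.Ioo 0 (Real.sqrt 2) :=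
      ⟨by positivity, half_lt_self (by positivity)⟩
    refine tendsto_of_tendsto_of_tendsto_of_le_of_le' tendsto_const_nhds
      (tendsto_barrier_zero (P := fun _ => 1) continuous_const) ?_ ?_
    · filter_upwards [Ioo_mem_nhdsGT hs₀pos] with x hx using (hpos x hx).le
    · filter_upwards [Ioo_mem_nhdsGT hs₀pos] with x hx
      have h := (hbd _ hμ x hx).2
      rw [rpow_add_half hx.1 1 (by norm_num)] at h
      simpa [barrier] using h
  intro s hs
  have hU : v s ≤ barrier (fun x => 1 - 3 * x + 24 * x ^ 2) s := by
    refine le_barrier (P' := fun x => -3 + 48 * x) hode hlim (fun x => ?_) (fun x hx => ?_)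
      (fun x hx => ?_) hs
    · exact ((((hasDerivAt_id x).const_mul 3).const_sub 1).add
        ((hasDerivAt_pow 2 x).const_mul 24)).congr_deriv (by norm_num; ring)
    · nlinarith [sq_nonneg (16 * x - 1)]
    · have h : 0 ≤ x ^ 3 * (285 - 864 * x + 4032 * x ^ 2) :=
        mul_nonneg (pow_nonneg hx.1.le 3) (by nlinarith [sq_nonneg (28 * x - 3)])
      linear_combination h
  have hL : barrier (fun x => 1 - 3 * x + 24 * x ^ 2 - 285 * x ^ 3) s ≤ v s := by
    refine barrier_le (P' := fun x => -3 + 48 * x - 855 * x ^ 2) hpos hode hlim (fun x => ?_)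
      (fun x hx => ?_) (fun x hx => ?_) hs
    · exact (((((hasDerivAt_id x).const_mul 3).const_sub 1).add
        ((hasDerivAt_pow 2 x).const_mul 24)).sub
        ((hasDerivAt_pow 3 x).const_mul 285)).congr_deriv (by norm_num; ring)
    · have hx8 : x ≤ 1 / 8 := hx.2.le.trans hs₀le
      have h3 : x ^ 2 * x ≤ x ^ 2 * (1 / 8) := mul_le_mul_of_nonneg_left hx8 (sq_nonneg x)
      nlinarith [hx.1]
    · have hx8 : x ≤ 1 / 8 := hx.2.le.trans hs₀le
      have h3 : x ^ 2 * x ≤ x ^ 2 * (1 / 8) := mul_le_mul_of_nonneg_left hx8 (sq_nonneg x)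
      have h : 0 ≤ x ^ 4 * (4284 - 16002 * x + 109440 * x ^ 2 - 731025 * x ^ 3) :=
        mul_nonneg (pow_nonneg hx.1.le 4) (by nlinarith [sq_nonneg x])
      linear_combination h
  rw [rpow_add_half hs.1 1 (by norm_num), rpow_add_half hs.1 2 (by norm_num),
    rpow_add_half hs.1 3 (by norm_num), rpow_add_half hs.1 4 (by norm_num)]
  unfold barrier at hU hL
  constructor
  · linear_combination hL
  · linear_combination hU
end

section
/- For every s₀ ∈ (0, 1/8) there exists a twice differentiable function q̄ : (0, ∞) → ℝ with −s₀ < q̄(x) < 0, solving −q̄''(x) + q̄(x) + q̄'(x)/√(−2 q̄(x)) = 0 for all x > 0 with lim_{x→0⁺} q̄(x) = −s₀ and lim_{x→∞} q̄(x) = 0, satisfying q̄'(x) > 0 for all x > 0 and, in addition, −3·(s₀^{−1/2} + x/(2√2))^{−4} ≤ q̄''(x) ≤ 0 for all x > 0. -/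
open MeasureTheory Set Filter Topology

/-- The bounded solution of `u' = 3 u - h` for bounded continuous `h`. -/
noncomputable def boundedSolution (h : ℝ → ℝ) (σ : ℝ) : ℝ :=
  Real.exp (3 * σ) * ∫ τ in Ioi σ, Real.exp (-3 * τ) * h τ

lemma integrableOn_exp_mul_of_bounded {h : ℝ → ℝ} {M : ℝ} (hc : Continuous h)
    (hM : ∀ τ, |h τ| ≤ M) (a : ℝ) :
    IntegrableOn (fun τ => Real.exp (-3 * τ) * h τ) (Ioi a) := by
  refine Integrable.mono' ((integrableOn_exp_mul_Ioi (by norm_num : (-3 : ℝ) < 0) a).mul_const M)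
    (by fun_prop) (Eventually.of_forall fun τ => ?_)
  rw [Real.norm_eq_abs, abs_mul, Real.abs_exp]
  exact mul_le_mul_of_nonneg_left (hM τ) (Real.exp_pos _).le

lemma abs_boundedSolution_le {h : ℝ → ℝ} {M : ℝ} (hM : ∀ τ, |h τ| ≤ M) (σ : ℝ) :
    |boundedSolution h σ| ≤ M / 3 := by
  have hint := integrableOn_exp_mul_Ioi (by norm_num : (-3 : ℝ) < 0) σ
  have key := norm_integral_le_of_norm_le (hint.mul_const M)
    (f := fun τ => Real.exp (-3 * τ) * h τ) (Eventually.of_forall fun τ => by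
      rw [Real.norm_eq_abs, abs_mul, Real.abs_exp]
      exact mul_le_mul_of_nonneg_left (hM τ) (Real.exp_pos _).le)
  rw [integral_mul_const, integral_exp_mul_Ioi (by norm_num), Real.norm_eq_abs] at key
  rw [boundedSolution, abs_mul, Real.abs_exp]
  calc _ ≤ Real.exp (3 * σ) * (-Real.exp (-3 * σ) / -3 * M) :=
        mul_le_mul_of_nonneg_left key (Real.exp_pos _).le
    _ = (Real.exp (3 * σ) * Real.exp (-3 * σ)) * (M / 3) := by ring
    _ = M / 3 := by rw [← Real.exp_add]; simp

lemma hasDerivAt_boundedSolution {h : ℝ → ℝ} {M : ℝ} (hc : Continuous h)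
    (hM : ∀ τ, |h τ| ≤ M) (σ : ℝ) :
    HasDerivAt (boundedSolution h) (3 * boundedSolution h σ - h σ) σ := by
  set f : ℝ → ℝ := fun τ => Real.exp (-3 * τ) * h τ with hf
  have hfc : Continuous f := by fun_prop
  have hint := integrableOn_exp_mul_of_bounded hc hM
  have hsplit : ∀ s, ∫ τ in Ioi s, f τ = (∫ τ in Ioi 0, f τ) - ∫ τ in (0 : ℝ)..s, f τ := fun s => by
    rw [← intervalIntegral.integral_interval_add_Ioi (hint 0) (hint s)]; ring
  have h1 : HasDerivAt (fun s => ∫ τ in Ioi s, f τ) (-f σ) σ := by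
    rw [funext hsplit]
    exact ((hfc.integral_hasStrictDerivAt 0 σ).hasDerivAt).const_sub _
  have h2 : HasDerivAt (fun s : ℝ => Real.exp (3 * s)) (Real.exp (3 * σ) * 3) σ := by
    simpa using ((hasDerivAt_id σ).const_mul (3 : ℝ)).exp
  refine (h2.mul h1).congr_deriv ?_
  have h3 : Real.exp (3 * σ) * Real.exp (-3 * σ) = 1 := by rw [← Real.exp_add]; simp
  simp only [boundedSolution, hf]
  linear_combination (-h σ) * h3

lemma boundedSolution_sub {h k : ℝ → ℝ} {M N : ℝ} (hc : Continuous h) (hM : ∀ τ, |h τ| ≤ M)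
    (kc : Continuous k) (kN : ∀ τ, |k τ| ≤ N) (σ : ℝ) :
    boundedSolution (fun τ => h τ - k τ) σ = boundedSolution h σ - boundedSolution k σ := by
  simp only [boundedSolution, mul_sub]
  rw [integral_sub (integrableOn_exp_mul_of_bounded hc hM σ)
    (integrableOn_exp_mul_of_bounded kc kN σ), mul_sub]

lemma exists_bounded_solution {G : ℝ → ℝ → ℝ} {M : ℝ} (hc : Continuous (Function.uncurry G))
    (hM : ∀ τ a, |G τ a| ≤ M) (hL : ∀ τ a b, |G τ a - G τ b| ≤ 2 * |a - b|) :
    ∃ v : ℝ → ℝ, (∃ C, ∀ σ, |v σ| ≤ C) ∧ ∀ σ, HasDerivAt v (3 * v σ - G σ (v σ)) σ := by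
  have hcomp : ∀ v : BoundedContinuousFunction ℝ ℝ, Continuous fun τ => G τ (v τ) := fun v =>
    hc.comp (continuous_id.prodMk v.continuous)
  let T : BoundedContinuousFunction ℝ ℝ → BoundedContinuousFunction ℝ ℝ := fun v =>
    BoundedContinuousFunction.ofNormedAddCommGroup (boundedSolution fun τ => G τ (v τ))
      (continuous_iff_continuousAt.2 fun σ =>
        (hasDerivAt_boundedSolution (hcomp v) (fun τ => hM τ _) σ).continuousAt) (M / 3)
      (abs_boundedSolution_le fun τ => hM τ _)
  have hT : ContractingWith (2 / 3) T := by
    refine ⟨by rw [div_lt_one] <;> norm_num, LipschitzWith.of_dist_le_mul fun v w => ?_⟩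
    refine (BoundedContinuousFunction.dist_le (by positivity)).2 fun σ => ?_
    change |boundedSolution _ σ - boundedSolution _ σ| ≤ _
    rw [← boundedSolution_sub (hcomp v) (fun τ => hM τ _) (hcomp w) (fun τ => hM τ _)]
    refine (abs_boundedSolution_le (M := 2 * dist v w) (fun τ => ?_) σ).trans_eq ?_
    · refine (hL _ _ _).trans ?_
      have := BoundedContinuousFunction.dist_coe_le_dist (f := v) (g := w) τ
      rw [Real.dist_eq] at this
      linarith
    · push_cast; ring
  set v := ContractingWith.fixedPoint T hT with hv
  have hfix : T v = v := hT.fixedPoint_isFixedPt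
  have hfun : (v : ℝ → ℝ) = boundedSolution fun τ => G τ (v τ) :=
    (congrArg (fun f : BoundedContinuousFunction ℝ ℝ => (f : ℝ → ℝ)) hfix).symm
  refine ⟨v, ⟨‖v‖, fun σ => v.norm_coe_le_norm σ⟩, fun σ => ?_⟩
  have := hasDerivAt_boundedSolution (hcomp v) (fun τ => hM τ _) σ
  rwa [← hfun] at this

lemma nonpos_of_three_mul_le_deriv {e e' : ℝ → ℝ} {a C : ℝ} (hC : ∀ σ, a ≤ σ → e σ ≤ C)
    (hd : ∀ σ, a ≤ σ → HasDerivAt e (e' σ) σ) (he : ∀ σ, a ≤ σ → 3 * e σ ≤ e' σ)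
    {σ : ℝ} (hσ : a ≤ σ) : e σ ≤ 0 := by
  have hd' : ∀ s, a ≤ s →
      HasDerivAt (fun s => Real.exp (-3 * s) * e s) (Real.exp (-3 * s) * (e' s - 3 * e s)) s := by
    intro s hs
    have h2 : HasDerivAt (fun s : ℝ => Real.exp (-3 * s)) (Real.exp (-3 * s) * (-3)) s := by
      simpa using ((hasDerivAt_id s).const_mul (-3 : ℝ)).exp
    exact (h2.mul (hd s hs)).congr_deriv (by ring)
  have hmono : MonotoneOn (fun s => Real.exp (-3 * s) * e s) (Ici a) := by
    refine monotoneOn_of_deriv_nonneg (convex_Ici a)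
      (fun s hs => (hd' s hs).continuousAt.continuousWithinAt) ?_ ?_ <;>
      rw [interior_Ici]
    · exact fun s hs => (hd' s (le_of_lt hs)).differentiableAt.differentiableWithinAt
    · intro s hs
      rw [(hd' s (le_of_lt hs)).deriv]
      exact mul_nonneg (Real.exp_pos _).le (sub_nonneg.2 (he s (le_of_lt hs)))
  have hlim : Tendsto (fun s : ℝ => Real.exp (-3 * s) * C) atTop (𝓝 0) := by
    have : Tendsto (fun s : ℝ => Real.exp (-3 * s)) atTop (𝓝 0) :=
      Real.tendsto_exp_atBot.comp (tendsto_id.const_mul_atTop_of_neg (by norm_num))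
    simpa using this.mul_const C
  have hle : Real.exp (-3 * σ) * e σ ≤ 0 := by
    refine ge_of_tendsto hlim ((eventually_ge_atTop σ).mono fun s hs => ?_)
    exact (hmono hσ (hσ.trans hs) hs).trans
      (mul_le_mul_of_nonneg_left (hC s (hσ.trans hs)) (Real.exp_pos _).le)
  by_contra! hpos
  exact absurd (mul_pos (Real.exp_pos (-3 * σ)) hpos) hle.not_gt

lemma exists_autonomous_solution {g : ℝ → ℝ} (hc : Continuous g) (hpos : ∀ y, 0 < g y)
    (hle : ∀ y, g y ≤ 1) (y₀ : ℝ) :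
    ∃ Y : ℝ → ℝ, Y 0 = y₀ ∧ ∀ x, HasDerivAt Y (g (Y x)) x := by
  set X : ℝ → ℝ := fun y => ∫ t in y₀..y, (g t)⁻¹ with hX
  have hgc : Continuous fun t => (g t)⁻¹ := hc.inv₀ fun y => (hpos y).ne'
  have hXd : ∀ y, HasDerivAt X (g y)⁻¹ y := fun y => (hgc.integral_hasStrictDerivAt y₀ y).hasDerivAt
  have hX0 : X y₀ = 0 := by simp [hX]
  have hmono : StrictMono X := strictMono_of_hasDerivAt_pos hXd fun y => inv_pos.2 (hpos y)
  have hXc : Continuous X := continuous_iff_continuousAt.2 fun y => (hXd y).continuousAt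
  have hsub : Monotone fun y => X y - y :=
    monotone_of_hasDerivAt_nonneg (fun y => (hXd y).sub (hasDerivAt_id y)) fun y =>
      sub_nonneg.2 ((one_le_inv₀ (hpos y)).2 (hle y))
  have hsurj : Function.Surjective X := by
    refine hXc.surjective ?_ ?_
    · refine tendsto_atTop_mono' _ ((eventually_ge_atTop y₀).mono fun y hy => ?_)
        (tendsto_atTop_add_const_right _ (-y₀) tendsto_id)
      have := hsub hy
      simp only [hX0, id] at *
      linarith
    · refine tendsto_atBot_mono' _ ((eventually_le_atBot y₀).mono fun y hy => ?_)
        (tendsto_atBot_add_const_right _ (-y₀) tendsto_id)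
      have := hsub hy
      simp only [hX0, id] at *
      linarith
  let e := hmono.orderIsoOfSurjective X hsurj
  have hright : ∀ x, X (e.symm x) = x := e.apply_symm_apply
  refine ⟨e.symm, hmono.injective ((hright 0).trans hX0.symm), fun x => ?_⟩
  have := HasDerivAt.of_local_left_inverse e.symm.continuous.continuousAt (hXd (e.symm x))
    (inv_pos.2 (hpos _)).ne' (Eventually.of_forall hright)
  rwa [inv_inv] at this

lemma sub_bounds_of_le {β c d : ℝ} (hβ : β ∈ Icc 0 (3 / 8)) (hc : 0 ≤ c) (hcd : c ≤ d)
    (hd : d ≤ 3 / 8) :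
    3 * c - c / (1 - c) + (1 - c) * β ≤ 3 * d - d / (1 - d) + (1 - d) * β ∧
    3 * d - d / (1 - d) + (1 - d) * β ≤ 3 * c - c / (1 - c) + (1 - c) * β + 2 * (d - c) := by
  obtain ⟨hβ0, hβ1⟩ := hβ
  have h1 : 5 / 8 ≤ 1 - c := by linarith
  have h2 : 5 / 8 ≤ 1 - d := by linarith
  have hp1 : 25 / 64 ≤ (1 - c) * (1 - d) := by nlinarith
  have hp2 : (1 - c) * (1 - d) ≤ 1 := by nlinarith
  have hr1 : 1 ≤ ((1 - c) * (1 - d))⁻¹ := (one_le_inv₀ (by linarith)).2 hp2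
  have hr2 : ((1 - c) * (1 - d))⁻¹ ≤ 64 / 25 :=
    (inv_anti₀ (by norm_num) hp1).trans_eq (by norm_num)
  have heq : d / (1 - d) - c / (1 - c) = (d - c) * ((1 - c) * (1 - d))⁻¹ := by
    have : 1 - c ≠ 0 := by linarith
    have : 1 - d ≠ 0 := by linarith
    field_simp
    ring
  have hs : 0 ≤ d - c := sub_nonneg.2 hcd
  have m1 := mul_le_mul_of_nonneg_left hr1 hs
  have m2 := mul_le_mul_of_nonneg_left hr2 hs
  have m3 := mul_le_mul_of_nonneg_left hβ1 hs
  have m4 := mul_nonneg hs hβ0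
  constructor <;> linarith

lemma abs_sub_le_of_mem_Icc {β c d : ℝ} (hβ : β ∈ Icc 0 (3 / 8)) (hc : c ∈ Icc 0 (3 / 8))
    (hd : d ∈ Icc 0 (3 / 8)) :
    |(3 * c - c / (1 - c) + (1 - c) * β) - (3 * d - d / (1 - d) + (1 - d) * β)|
      ≤ 2 * |c - d| := by
  rcases le_total c d with h | h
  · obtain ⟨h1, h2⟩ := sub_bounds_of_le hβ hc.1 h hd.2
    rw [abs_of_nonpos (by linarith), abs_of_nonpos (by linarith)]
    linarith
  · obtain ⟨h1, h2⟩ := sub_bounds_of_le hβ hd.1 h hc.2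
    rw [abs_of_nonneg (by linarith), abs_of_nonneg (by linarith)]
    linarith

lemma exists_defect : ∃ v : ℝ → ℝ, Continuous v ∧ (∀ σ, 0 ≤ v σ ∧ v σ ≤ 3 / 8) ∧
    ∀ σ, 4 ≤ σ → v σ ≤ 3 / (2 * σ) ∧
      HasDerivAt v (v σ / (1 - v σ) - (1 - v σ) * (3 / (2 * σ))) σ := by
  set β : ℝ → ℝ := fun τ => 3 / (2 * max τ 4) with hβ
  have hm : ∀ τ : ℝ, 4 ≤ max τ 4 := fun τ => le_max_right _ _
  have hβm : ∀ τ, β τ ∈ Icc 0 (3 / 8) := fun τ => by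
    have := hm τ
    refine ⟨by positivity, ?_⟩
    rw [hβ, div_le_div_iff₀ (by linarith) (by norm_num)]
    linarith
  have hβc : Continuous β := by
    refine continuous_const.div (by fun_prop) fun τ => ?_
    have := hm τ
    positivity
  set κ : ℝ → ℝ → ℝ := fun τ a => max 0 (min a (β τ)) with hκ
  have hκ0 : ∀ τ a, 0 ≤ κ τ a := fun τ a => le_max_left _ _
  have hκβ : ∀ τ a, κ τ a ≤ β τ := fun τ a => max_le (hβm τ).1 (min_le_right _ _)
  have hκm : ∀ τ a, κ τ a ∈ Icc 0 (3 / 8) := fun τ a => ⟨hκ0 τ a, (hκβ τ a).trans (hβm τ).2⟩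
  have hκL : ∀ τ a b, |κ τ a - κ τ b| ≤ |a - b| := fun τ a b => by
    have h1 := abs_max_sub_max_le_max 0 (min a (β τ)) 0 (min b (β τ))
    have h2 := abs_min_sub_min_le_max a (β τ) b (β τ)
    simp only [sub_self, abs_zero, abs_nonneg, max_eq_left, max_eq_right] at h1 h2
    exact h1.trans h2
  set G : ℝ → ℝ → ℝ := fun τ a =>
    3 * κ τ a - κ τ a / (1 - κ τ a) + (1 - κ τ a) * β τ with hG
  have hGc : Continuous (Function.uncurry G) := by
    have hk : Continuous fun p : ℝ × ℝ => κ p.1 p.2 := by simp only [hκ]; fun_prop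
    have hb : Continuous fun p : ℝ × ℝ => β p.1 := by fun_prop
    refine ((continuous_const.mul hk).sub (hk.div (continuous_const.sub hk) fun p => ?_)).add
      ((continuous_const.sub hk).mul hb)
    have := (hκm p.1 p.2).2
    change 1 - κ p.1 p.2 ≠ 0
    linarith
  have hGup : ∀ τ a, G τ a ≤ 3 * β τ := fun τ a => by
    obtain ⟨hb0, hb1⟩ := hβm τ
    refine (sub_bounds_of_le (hβm τ) (hκ0 τ a) (hκβ τ a) hb1).1.trans ?_
    have : β τ ≤ β τ / (1 - β τ) := le_div_self hb0 (by linarith) (by linarith)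
    nlinarith
  have hGnn : ∀ τ a, 0 ≤ G τ a := fun τ a => by
    have := (sub_bounds_of_le (hβm τ) le_rfl (hκ0 τ a) (hκm τ a).2).1
    simp only [mul_zero, zero_div, sub_zero, zero_add, one_mul] at this
    exact (hβm τ).1.trans this
  obtain ⟨v, ⟨C, hC⟩, hv⟩ := exists_bounded_solution (M := 9 / 8) hGc
    (fun τ a => abs_le.2 ⟨by linarith [hGnn τ a], by linarith [hGup τ a, (hβm τ).2]⟩)
    (fun τ a b => (abs_sub_le_of_mem_Icc (hβm τ) (hκm τ a) (hκm τ b)).trans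
      (mul_le_mul_of_nonneg_left (hκL τ a b) (by norm_num)))
  have hv0 : ∀ σ, 0 ≤ v σ := fun σ => neg_nonpos.1 <|
    nonpos_of_three_mul_le_deriv (e := fun s => -v s) (a := σ) (C := C)
      (fun s _ => (neg_le_abs _).trans (hC s)) (fun s _ => (hv s).neg)
      (fun s _ => by linarith [hGnn s (v s)]) le_rfl
  have hv1 : ∀ σ, v σ ≤ 3 / 8 := fun σ => sub_nonpos.1 <|
    nonpos_of_three_mul_le_deriv (e := fun s => v s - 3 / 8) (a := σ) (C := C)
      (fun s _ => by linarith [(le_abs_self _).trans (hC s)]) (fun s _ => (hv s).sub_const _)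
      (fun s _ => by linarith [hGup s (v s), (hβm s).2]) le_rfl
  have hβeq : ∀ σ, 4 ≤ σ → β σ = 3 / (2 * σ) := fun σ hσ => by simp only [hβ, max_eq_left hσ]
  have hv2 : ∀ σ, 4 ≤ σ → v σ ≤ 3 / (2 * σ) := fun σ hσ => sub_nonpos.1 <|
    nonpos_of_three_mul_le_deriv (e := fun s => v s - 3 / (2 * s)) (a := 4) (C := C)
      (e' := fun s => (3 * v s - G s (v s)) - -(3 / (2 * s ^ 2)))
      (fun s hs => by
        have : 0 ≤ 3 / (2 * s) := by positivity
        linarith [(le_abs_self _).trans (hC s)])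
      (fun s hs => by
        have hs0 : s ≠ 0 := by positivity
        refine (hv s).sub ((((hasDerivAt_id s).const_mul 2).fun_inv
          (by simpa using hs0)).const_mul 3 |>.congr_deriv ?_)
        simp only [id]
        field_simp)
      (fun s hs => by
        have : 0 ≤ 3 / (2 * s ^ 2) := by positivity
        have := hGup s (v s)
        rw [hβeq s hs] at this
        linarith) hσ
  refine ⟨v, continuous_iff_continuousAt.2 fun σ => (hv σ).continuousAt,
    fun σ => ⟨hv0 σ, hv1 σ⟩, fun σ hσ => ⟨hv2 σ hσ, (hv σ).congr_deriv ?_⟩⟩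
  have hk : κ σ (v σ) = v σ := by
    simp only [hκ, hβeq σ hσ, min_eq_left (hv2 σ hσ), max_eq_right (hv0 σ)]
  simp only [hG, hk, hβeq σ hσ]
  ring


/-- The stationary solution `q̄` of the degenerate problem
`-q̄'' + q̄ + q̄'/√(-2q̄) = 0` on `(0, ∞)` with `q̄(0⁺) = -s₀`, `q̄(+∞) = 0` is strictly
increasing and satisfies `-3 (s₀^{-1/2} + x/(2√2))^{-4} ≤ q̄''(x) ≤ 0`. -/
theorem stmt_8 (s₀ : ℝ) (hs₀ : s₀ ∈ Set.Ioo 0 (1/8 : ℝ)) :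
    ∃ q : ℝ → ℝ,
      (∀ x ∈ Set.Ioi (0:ℝ), DifferentiableAt ℝ q x ∧ DifferentiableAt ℝ (deriv q) x) ∧
      (∀ x ∈ Set.Ioi (0:ℝ), -s₀ < q x ∧ q x < 0) ∧
      (∀ x ∈ Set.Ioi (0:ℝ),
        -(deriv (deriv q) x) + q x + deriv q x / Real.sqrt (-(2 * q x)) = 0) ∧
      Filter.Tendsto q (nhdsWithin 0 (Set.Ioi 0)) (nhds (-s₀)) ∧
      Filter.Tendsto q Filter.atTop (nhds 0) ∧
      (∀ x ∈ Set.Ioi (0:ℝ), 0 < deriv q x) ∧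
      (∀ x ∈ Set.Ioi (0:ℝ),
        -(3 / (1 / Real.sqrt s₀ + x / (2 * Real.sqrt 2)) ^ 4) ≤ deriv (deriv q) x ∧
        deriv (deriv q) x ≤ 0) := by
  obtain ⟨hs0, hs1⟩ := hs₀
  obtain ⟨v, hvc, hvb, hv⟩ := exists_defect
  have h2 : 0 < Real.sqrt 2 := by positivity
  have h2sq : Real.sqrt 2 ^ 2 = 2 := Real.sq_sqrt (by norm_num)
  have h2le : 1 ≤ Real.sqrt 2 := Real.one_le_sqrt.2 (by norm_num)
  set y₀ := 1 / Real.sqrt s₀ with hy₀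
  have hy₀pos : 0 < y₀ := by positivity
  have hy₀sq : (y₀ ^ 2)⁻¹ = s₀ := by
    rw [hy₀, div_pow, Real.sq_sqrt hs0.le]; simp
  have hy₀8 : 8 ≤ y₀ ^ 2 := by
    rw [← inv_inv (y₀ ^ 2), hy₀sq, le_inv_comm₀ (by norm_num) hs0]
    linarith
  obtain ⟨Y, hY0, hYd⟩ := exists_autonomous_solution
    (g := fun y => (1 - v (y ^ 2 / 2)) / Real.sqrt 2) (by fun_prop)
    (fun y => div_pos (by linarith [(hvb (y ^ 2 / 2)).2]) h2)
    (fun y => (div_le_one h2).2 (by linarith [(hvb (y ^ 2 / 2)).1])) y₀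
  have hYlow : ∀ x, 0 ≤ x → y₀ + x / (2 * Real.sqrt 2) ≤ Y x := fun x hx => by
    have hmono : Monotone fun x => Y x - (2 * Real.sqrt 2)⁻¹ * x := by
      refine monotone_of_hasDerivAt_nonneg
        (fun x => (hYd x).sub ((hasDerivAt_id x).const_mul _)) fun x => sub_nonneg.2 ?_
      have := (hvb (Y x ^ 2 / 2)).2
      rw [mul_one, mul_inv, ← div_eq_mul_inv]
      gcongr
      linarith
    have := hmono hx
    simp only [mul_zero, hY0] at this
    rw [div_eq_inv_mul]
    linarith
  have hYgt : ∀ x, 0 < x → y₀ < Y x := fun x hx =>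
    lt_of_lt_of_le (lt_add_of_pos_right _ (by positivity)) (hYlow x hx.le)
  have hYpos : ∀ x, 0 < x → 0 < Y x := fun x hx => hy₀pos.trans (hYgt x hx)
  have hY4 : ∀ x, 0 < x → 4 ≤ Y x ^ 2 / 2 := fun x hx => by
    nlinarith [hYgt x hx]
  set q : ℝ → ℝ := fun x => -(Y x ^ 2)⁻¹ with hq
  have hq1 : ∀ x, 0 < x →
      HasDerivAt q (Real.sqrt 2 * (1 - v (Y x ^ 2 / 2)) / Y x ^ 3) x := fun x hx => by
    have hne := (hYpos x hx).ne'
    refine (((hYd x).pow 2).inv (pow_ne_zero 2 hne)).neg.congr_deriv ?_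
    simp only [Pi.pow_apply]
    field_simp
    rw [h2sq]
    push_cast
    ring
  have hq2 : ∀ x, 0 < x → HasDerivAt (deriv q) (-v (Y x ^ 2 / 2) / Y x ^ 2) x := fun x hx => by
    have hne := (hYpos x hx).ne'
    have hev : deriv q =ᶠ[𝓝 x] fun x => Real.sqrt 2 * (1 - v (Y x ^ 2 / 2)) / Y x ^ 3 :=
      (eventually_gt_nhds hx).mono fun z hz => (hq1 z hz).deriv
    refine HasDerivAt.congr_of_eventuallyEq ?_ hev
    have hsq : HasDerivAt (fun x => Y x ^ 2 / 2) _ x := ((hYd x).fun_pow 2).div_const 2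
    have hvd : HasDerivAt (fun x => v (Y x ^ 2 / 2)) _ x :=
      HasDerivAt.comp x (hv _ (hY4 x hx)).2 hsq
    refine (((hvd.const_sub 1).const_mul (Real.sqrt 2)).fun_div ((hYd x).fun_pow 3)
      (pow_ne_zero 3 hne)).congr_deriv ?_
    have hv1 : 1 - v (Y x ^ 2 / 2) ≠ 0 := by linarith [(hvb (Y x ^ 2 / 2)).2]
    generalize v (Y x ^ 2 / 2) = w at *
    push_cast
    field_simp
    ring
  have hYinf : Tendsto Y atTop atTop := by
    refine tendsto_atTop_mono' _ ((eventually_ge_atTop 0).mono hYlow) ?_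
    exact tendsto_atTop_add_const_left _ _ (tendsto_id.atTop_div_const (by positivity))
  refine ⟨q, fun x hx => ⟨(hq1 x hx).differentiableAt, (hq2 x hx).differentiableAt⟩,
    fun x hx => ⟨?_, ?_⟩, fun x hx => ?_, ?_, ?_, fun x hx => ?_, fun x hx => ?_⟩
  · rw [neg_lt_neg_iff, ← hy₀sq]
    have := hYgt x hx
    gcongr
  · have := hYpos x hx
    exact neg_neg_of_pos (by positivity)
  · have hp := hYpos x hx
    have hsqrt : Real.sqrt (-(2 * q x)) = Real.sqrt 2 / Y x := by
      rw [show -(2 * q x) = 2 / Y x ^ 2 by simp only [hq]; ring,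
        Real.sqrt_div (by norm_num), Real.sqrt_sq hp.le]
    rw [(hq2 x hx).deriv, (hq1 x hx).deriv, hsqrt]
    simp only [hq]
    field_simp
    ring
  · have hcont : ContinuousAt q 0 :=
      (((hYd 0).continuousAt.pow 2).inv₀ (by rw [Pi.pow_apply, hY0]; positivity)).neg
    have := hcont.tendsto
    simp only [hq, hY0, hy₀sq] at this
    exact this.mono_left nhdsWithin_le_nhds
  · have := (tendsto_inv_atTop_zero.comp ((tendsto_pow_atTop two_ne_zero).comp hYinf)).neg
    simpa [hq, Function.comp_def] using this
  · rw [(hq1 x hx).deriv]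
    have := hYpos x hx
    have : 0 < 1 - v (Y x ^ 2 / 2) := by linarith [(hvb (Y x ^ 2 / 2)).2]
    positivity
  · rw [(hq2 x hx).deriv, neg_div]
    have hp := hYpos x hx
    have hx' : 0 < x := hx
    refine ⟨neg_le_neg ?_, neg_nonpos.2 (div_nonneg (hvb _).1 (by positivity))⟩
    calc v (Y x ^ 2 / 2) / Y x ^ 2 ≤ 3 / (2 * (Y x ^ 2 / 2)) / Y x ^ 2 := by
          gcongr
          exact (hv _ (hY4 x hx)).1
      _ = 3 / Y x ^ 4 := by field_simp
      _ ≤ _ := by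
          gcongr
          exact hYlow x hx'.le
end

section
/- There exists δ* ∈ (0, 1/8] such that for every s₀ ∈ (0, δ*) there exist a four-times differentiable function q̄ : (0, ∞) → ℝ with −s₀ < q̄(x) < 0, solving −q̄''(x) + q̄(x) + q̄'(x)/√(−2 q̄(x)) = 0 for all x > 0 with lim_{x→0⁺} q̄(x) = −s₀ and lim_{x→∞} q̄(x) = 0, and a constant C > 0, such that for all x > 0: |q̄'''(x)| ≤ 6√2·(s₀^{−1/2} + x/(2√2))^{−5} + C·(s₀^{−1/2} + x/(2√2))^{−7} and |q̄''''(x)| ≤ 222·(s₀^{−1/2} + x/(2√2))^{−6} + C·(s₀^{−1/2} + x/(2√2))^{−8}. -/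
open MeasureTheory Set Filter Topology

/-- The bounded solution `y` of `y' = a y - g` for bounded continuous `g` and `a > 0`. -/
noncomputable def expTail (a : ℝ) (g : ℝ → ℝ) (τ : ℝ) : ℝ :=
  Real.exp (a * τ) * ∫ t in Ioi τ, Real.exp (-a * t) * g t

lemma integrableOn_exp_mul_of_bounded_s9 {a lo hi : ℝ} (ha : 0 < a) {g : ℝ → ℝ} (hg : Continuous g)
    (hb : ∀ t, lo ≤ g t ∧ g t ≤ hi) (τ : ℝ) :
    IntegrableOn (fun t => Real.exp (-a * t) * g t) (Ioi τ) := by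
  refine (integrableOn_exp_mul_Ioi (neg_lt_zero.mpr ha) τ).mul_bdd (c := max |lo| |hi|)
    hg.aestronglyMeasurable (ae_of_all _ fun t => ?_)
  exact abs_le_max_abs_abs (hb t).1 (hb t).2

lemma hasDerivAt_expTail {a lo hi : ℝ} (ha : 0 < a) {g : ℝ → ℝ} (hg : Continuous g)
    (hb : ∀ t, lo ≤ g t ∧ g t ≤ hi) (τ : ℝ) :
    HasDerivAt (expTail a g) (a * expTail a g τ - g τ) τ := by
  have hc : Continuous fun t => Real.exp (-a * t) * g t := by fun_prop
  have hi' := integrableOn_exp_mul_of_bounded_s9 ha hg hb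
  have h1 : HasDerivAt (fun τ => ∫ t in Ioi τ, Real.exp (-a * t) * g t)
      (-(Real.exp (-a * τ) * g τ)) τ := by
    have h2 := (hc.integral_hasStrictDerivAt 0 τ).hasDerivAt.const_sub
      (∫ t in Ioi 0, Real.exp (-a * t) * g t)
    refine h2.congr_of_eventuallyEq (Eventually.of_forall fun s => ?_)
    simp only
    rw [← intervalIntegral.integral_interval_add_Ioi (hi' 0) (hi' s)]
    ring
  have h3 : HasDerivAt (fun τ => Real.exp (a * τ)) (Real.exp (a * τ) * a) τ := by
    simpa using ((hasDerivAt_id τ).const_mul a).exp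
  refine (h3.mul h1).congr_deriv ?_
  have : Real.exp (a * τ) * Real.exp (-a * τ) = 1 := by
    rw [← Real.exp_add]; simp
  unfold expTail
  linear_combination (-g τ) * this

lemma expTail_const {a : ℝ} (ha : 0 < a) (c τ : ℝ) : expTail a (fun _ => c) τ = c / a := by
  unfold expTail
  rw [integral_mul_const, integral_exp_mul_Ioi (neg_lt_zero.mpr ha)]
  have : Real.exp (a * τ) * Real.exp (-a * τ) = 1 := by
    rw [← Real.exp_add]; simp
  linear_combination (c / a) * this

lemma expTail_mono {a lo hi lo' hi' : ℝ} (ha : 0 < a) {g k : ℝ → ℝ} (hg : Continuous g)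
    (hk : Continuous k) (hgb : ∀ t, lo ≤ g t ∧ g t ≤ hi) (hkb : ∀ t, lo' ≤ k t ∧ k t ≤ hi')
    (h : ∀ t, g t ≤ k t) (τ : ℝ) : expTail a g τ ≤ expTail a k τ := by
  unfold expTail
  gcongr ?_ * ?_
  exact integral_mono (integrableOn_exp_mul_of_bounded_s9 ha hg hgb τ)
    (integrableOn_exp_mul_of_bounded_s9 ha hk hkb τ)
    fun t => mul_le_mul_of_nonneg_left (h t) (Real.exp_pos _).le

lemma expTail_add_const {a lo hi : ℝ} (ha : 0 < a) {g : ℝ → ℝ} (hg : Continuous g)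
    (hgb : ∀ t, lo ≤ g t ∧ g t ≤ hi) (c τ : ℝ) :
    expTail a (fun t => g t + c) τ = expTail a g τ + c / a := by
  rw [← expTail_const ha c τ]
  unfold expTail
  rw [← mul_add, ← integral_add (integrableOn_exp_mul_of_bounded_s9 ha hg hgb τ)
    (integrableOn_exp_mul_of_bounded_s9 ha continuous_const (fun _ => ⟨le_refl c, le_refl c⟩) τ)]
  simp only [mul_add]

/-- A bounded global solution of `H' = a H - G τ H`, as the fixed point of a contraction. -/
lemma exists_bounded_solution_s9 {a k lo hi : ℝ} (hk : 0 ≤ k) (hka : k < a) {G : ℝ → ℝ → ℝ}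
    (hG : Continuous fun p : ℝ × ℝ => G p.1 p.2) (hb : ∀ t p, lo ≤ G t p ∧ G t p ≤ hi)
    (hlip : ∀ t p p', |G t p - G t p'| ≤ k * |p - p'|) :
    ∃ H : ℝ → ℝ, (∀ τ, lo / a ≤ H τ ∧ H τ ≤ hi / a) ∧
      ∀ τ, HasDerivAt H (a * H τ - G τ (H τ)) τ := by
  have ha : 0 < a := hk.trans_lt hka
  have hcont (H : BoundedContinuousFunction ℝ ℝ) : Continuous fun t => G t (H t) :=
    hG.comp (continuous_id.prodMk H.continuous)
  have hrange (H : BoundedContinuousFunction ℝ ℝ) (τ : ℝ) :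
      lo / a ≤ expTail a (fun t => G t (H t)) τ ∧ expTail a (fun t => G t (H t)) τ ≤ hi / a := by
    constructor
    · rw [← expTail_const ha lo τ]
      exact expTail_mono ha continuous_const (hcont H) (fun _ => ⟨le_refl lo, le_refl lo⟩)
        (fun t => hb t _) (fun t => (hb t _).1) τ
    · rw [← expTail_const ha hi τ]
      exact expTail_mono ha (hcont H) continuous_const (fun t => hb t _)
        (fun _ => ⟨le_refl hi, le_refl hi⟩) (fun t => (hb t _).2) τ
  let T : BoundedContinuousFunction ℝ ℝ → BoundedContinuousFunction ℝ ℝ := fun H =>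
    BoundedContinuousFunction.ofNormedAddCommGroup (expTail a fun t => G t (H t))
      (continuous_iff_continuousAt.mpr fun τ =>
        (hasDerivAt_expTail ha (hcont H) (fun t => hb t _) τ).continuousAt)
      (max |lo / a| |hi / a|) fun τ => abs_le_max_abs_abs (hrange H τ).1 (hrange H τ).2
  have hle (H K : BoundedContinuousFunction ℝ ℝ) (τ : ℝ) :
      expTail a (fun t => G t (H t)) τ ≤
        expTail a (fun t => G t (K t)) τ + k * dist H K / a := by
    rw [← expTail_add_const ha (hcont K) (fun t => hb t _)]
    refine expTail_mono (k := fun t => G t (K t) + k * dist H K) ha (hcont H)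
      ((hcont K).add continuous_const) (fun t => hb t _)
      (lo' := lo + k * dist H K) (hi' := hi + k * dist H K)
      (fun t => ⟨by linarith [(hb t (K t)).1], by linarith [(hb t (K t)).2]⟩) (fun t => ?_) τ
    have h1 := (le_abs_self _).trans (hlip t (H t) (K t))
    have h2 : |H t - K t| ≤ dist H K := by
      rw [← Real.dist_eq]; exact BoundedContinuousFunction.dist_coe_le_dist t
    nlinarith
  obtain ⟨κ, hκ⟩ : ∃ κ : NNReal, (κ : ℝ) = k / a :=
    ⟨(k / a).toNNReal, Real.coe_toNNReal _ (by positivity)⟩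
  have hT : ContractingWith κ T := by
    refine ⟨by rw [← NNReal.coe_lt_coe, hκ]; simpa [div_lt_one ha] using hka,
      LipschitzWith.of_dist_le_mul fun H K => ?_⟩
    have h0 : 0 ≤ k / a * dist H K := by positivity
    rw [hκ]
    refine (BoundedContinuousFunction.dist_le h0).mpr fun τ => ?_
    have h1 := hle H K τ
    have h2 := hle K H τ
    rw [dist_comm K H] at h2
    have h3 : k / a * dist H K = k * dist H K / a := by ring
    rw [Real.dist_eq, abs_le, h3]
    constructor
    · change _ ≤ expTail a (fun t => G t (H t)) τ - expTail a (fun t => G t (K t)) τ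
      linarith
    · change expTail a (fun t => G t (H t)) τ - expTail a (fun t => G t (K t)) τ ≤ _
      linarith
  obtain ⟨H, hH⟩ : ∃ H, T H = H := ⟨_, hT.fixedPoint_isFixedPt⟩
  have hH' : (expTail a fun t => G t (H t)) = H := congrArg DFunLike.coe hH
  refine ⟨H, fun τ => hH' ▸ hrange H τ, fun τ => ?_⟩
  have h := hasDerivAt_expTail ha (hcont H) (fun t => hb t _) τ
  rwa [hH'] at h

/-- With `z = 1 / √(-2q)` and `τ = z² / 2`, the slope `z' = H(τ)` of a decaying solution satisfies
`H_τ = (H - 1/2) / H + 3 H / (2 τ)`. -/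
lemma exists_slope : ∃ H : ℝ → ℝ, (∀ τ, 1 / 4 ≤ H τ ∧ H τ ≤ 1 / 2) ∧ Continuous H ∧
    ∀ τ, 2 ≤ τ → HasDerivAt H ((H τ - 1 / 2) / H τ + 3 * H τ / (2 * τ)) τ := by
  let c : ℝ → ℝ := fun p => max (1 / 4) (min p (1 / 2))
  have hc (p : ℝ) : 1 / 4 ≤ c p ∧ c p ≤ 1 / 2 :=
    ⟨le_max_left _ _, max_le (by norm_num) (min_le_right _ _)⟩
  have hc0 (p : ℝ) : c p ≠ 0 := by linarith [(hc p).1]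
  have hcc : Continuous c := by fun_prop
  have hclip (p p' : ℝ) : |c p - c p'| ≤ |p - p'| := by
    have h1 := abs_max_sub_max_le_abs (min p (1 / 2)) (min p' (1 / 2)) (1 / 4)
    have h2 := abs_min_sub_min_le_max p (1 / 2) p' (1 / 2)
    simp only [sub_self, abs_zero] at h2
    rw [max_eq_left (abs_nonneg _)] at h2
    simp only [c, max_comm (1 / 4 : ℝ)]
    exact h1.trans h2
  have hs (t : ℝ) : 0 ≤ 3 / (2 * max t 2) ∧ 3 / (2 * max t 2) ≤ 3 / 4 := by
    have : 2 ≤ max t 2 := le_max_right _ _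
    refine ⟨by positivity, ?_⟩
    rw [div_le_div_iff₀ (by positivity) (by norm_num)]
    linarith
  let G : ℝ → ℝ → ℝ := fun t p => 10 * c p - (c p - 1 / 2) / c p - 3 / (2 * max t 2) * c p
  have hG : Continuous fun p : ℝ × ℝ => G p.1 p.2 := by
    have h2 (p : ℝ × ℝ) : 2 * max p.1 2 ≠ 0 := by
      have : 2 ≤ max p.1 2 := le_max_right _ _
      positivity
    have hc2 : Continuous fun p : ℝ × ℝ => c p.2 := hcc.comp continuous_snd
    exact ((continuous_const.mul hc2).sub ((hc2.sub continuous_const).div hc2 fun p => hc0 p.2)).sub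
      ((continuous_const.div (by fun_prop) h2).mul hc2)
  have hb (t p : ℝ) : 5 / 2 ≤ G t p ∧ G t p ≤ 5 := by
    obtain ⟨h1, h2⟩ := hc p
    obtain ⟨h3, h4⟩ := hs t
    simp only [G]
    generalize c p = P at *
    generalize 3 / (2 * max t 2) = s at *
    have hP : 0 < P := by linarith
    have h5 : (P - 1 / 2) / P ≤ 2 * (P - 1 / 2) := by
      rw [div_le_iff₀ hP]
      nlinarith
    have h6 : 4 * (P - 1 / 2) ≤ (P - 1 / 2) / P := by
      rw [le_div_iff₀ hP]
      nlinarith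
    constructor <;> nlinarith
  have hlip (t p p' : ℝ) : |G t p - G t p'| ≤ 8 * |p - p'| := by
    refine le_trans ?_ (mul_le_mul_of_nonneg_left (hclip p p') (by norm_num))
    obtain ⟨h1, h2⟩ := hc p
    obtain ⟨h1', h2'⟩ := hc p'
    obtain ⟨h3, h4⟩ := hs t
    simp only [G]
    generalize c p = P at *
    generalize c p' = Q at *
    generalize 3 / (2 * max t 2) = s at *
    have hP : 0 < P := by linarith
    have hQ : 0 < Q := by linarith
    have h5 : 10 * P - (P - 1 / 2) / P - s * P - (10 * Q - (Q - 1 / 2) / Q - s * Q)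
        = (10 - s - 1 / (2 * (P * Q))) * (P - Q) := by
      field_simp
      ring
    have h6 : 2 ≤ 1 / (2 * (P * Q)) := by
      rw [le_div_iff₀ (by positivity)]
      nlinarith
    have h7 : 1 / (2 * (P * Q)) ≤ 8 := by
      rw [div_le_iff₀ (by positivity)]
      nlinarith
    rw [h5, abs_mul]
    refine mul_le_mul_of_nonneg_right ?_ (abs_nonneg _)
    rw [abs_le]
    constructor <;> linarith
  obtain ⟨H, hH, hd⟩ := exists_bounded_solution_s9 (a := 10) (by norm_num) (by norm_num) hG hb hlip
  have hH' (τ : ℝ) : 1 / 4 ≤ H τ ∧ H τ ≤ 1 / 2 :=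
    ⟨by linarith [(hH τ).1], by linarith [(hH τ).2]⟩
  refine ⟨H, hH', continuous_iff_continuousAt.mpr fun τ => (hd τ).continuousAt, fun τ hτ => ?_⟩
  have h1 : c (H τ) = H τ := by
    simp only [c]
    rw [min_eq_left (hH' τ).2, max_eq_right (hH' τ).1]
  refine (hd τ).congr_deriv ?_
  simp only [G]
  rw [h1, max_eq_left hτ]
  ring

lemma le_div_pow_of_deriv_ge {w w' : ℝ → ℝ} {T B M : ℝ} (hT : 0 < T) (hB : 0 ≤ B)
    (hd : ∀ τ, T < τ → HasDerivAt w (w' τ) τ) (hw : ∀ τ, T < τ → w τ - B * τ⁻¹ ^ 8 ≤ w' τ)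
    (hM : ∀ τ, T < τ → w τ ≤ M) {τ : ℝ} (hτ : T < τ) : w τ ≤ B * τ⁻¹ ^ 8 := by
  let φ : ℝ → ℝ := fun t => (w t - B * t⁻¹ ^ 8) * Real.exp (-t)
  have hφ (t : ℝ) (ht : T < t) : HasDerivAt φ
      ((w' t + 8 * B * t⁻¹ ^ 9 - (w t - B * t⁻¹ ^ 8)) * Real.exp (-t)) t := by
    have ht0 : t ≠ 0 := by linarith
    refine (((hd t ht).sub (((hasDerivAt_inv ht0).pow 8).const_mul B)).mul
      (hasDerivAt_neg t).exp).congr_deriv ?_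
    simp only [Pi.sub_apply, Pi.pow_apply]
    push_cast
    field_simp
    ring
  have hmono : MonotoneOn φ (Ioi T) := by
    refine monotoneOn_of_deriv_nonneg (convex_Ioi T)
      (fun t ht => (hφ t ht).continuousAt.continuousWithinAt) (fun t ht => ?_) fun t ht => ?_
    · rw [interior_Ioi] at ht
      exact (hφ t ht).differentiableAt.differentiableWithinAt
    · rw [interior_Ioi] at ht
      have ht' : T < t := ht
      have : 0 < t⁻¹ := inv_pos.mpr (hT.trans ht')
      rw [(hφ t ht).deriv]
      refine mul_nonneg ?_ (Real.exp_pos _).le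
      have : 0 ≤ 8 * B * t⁻¹ ^ 9 := by positivity
      linarith [hw t ht']
  have hlim : Tendsto (fun t => M * Real.exp (-t)) atTop (𝓝 0) := by
    simpa using (Real.tendsto_exp_neg_atTop_nhds_zero).const_mul M
  have h0 : φ τ ≤ 0 := by
    refine ge_of_tendsto hlim ?_
    filter_upwards [eventually_ge_atTop τ] with t ht
    have ht' : T < t := hτ.trans_le ht
    have h1 : 0 ≤ B * t⁻¹ ^ 8 := by positivity
    exact (hmono hτ ht' ht).trans
      (mul_le_mul_of_nonneg_right (by linarith [hM t ht']) (Real.exp_pos _).le)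
  have := nonpos_of_mul_nonpos_left h0 (Real.exp_pos _)
  linarith

/-- The squared error `w = (y - p)²` of the expansion `p` satisfies `w' ≥ w - O(e⁸)`. -/
lemma slope_error_ineq {e y : ℝ} (he0 : 0 < e) (he1 : e ≤ 1 / 10) (hl : 1 / 4 ≤ y)
    (hu : y ≤ 1 / 2) :
    (y - (1 / 2 - 3 / 8 * e + 3 / 4 * e ^ 2 - 285 / 128 * e ^ 3)) ^ 2 - 28800 * e ^ 8 ≤
      2 * (y - (1 / 2 - 3 / 8 * e + 3 / 4 * e ^ 2 - 285 / 128 * e ^ 3)) *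
        ((y - 1 / 2) / y + 3 / 2 * e * y
          - (3 / 8 * e ^ 2 - 3 / 2 * e ^ 3 + 855 / 128 * e ^ 4)) := by
  have hy : 0 < y := by linarith
  obtain ⟨p, hp⟩ : ∃ p, p = 1 / 2 - 3 / 8 * e + 3 / 4 * e ^ 2 - 285 / 128 * e ^ 3 := ⟨_, rfl⟩
  obtain ⟨r, hr⟩ : ∃ r, r = 3 / 8 * e ^ 2 - 3 / 2 * e ^ 3 + 855 / 128 * e ^ 4 := ⟨_, rfl⟩
  rw [← hp, ← hr]
  obtain ⟨R, hR⟩ : ∃ R, R = p * r - (p - 1 / 2) - 3 / 2 * e * p ^ 2 := ⟨_, rfl⟩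
  obtain ⟨A, hA⟩ : ∃ A, A = 1 + 3 / 2 * e * (y + p) - r := ⟨_, rfl⟩
  have e2 : e ^ 2 ≤ 1 / 100 := by nlinarith
  have e3 : e ^ 3 ≤ 1 / 1000 := by nlinarith [pow_pos he0 2]
  have e4 : e ^ 4 ≤ 1 / 10000 := by nlinarith [pow_pos he0 3]
  have hA' : 1 / 2 ≤ A := by
    have hp0 : 0 ≤ p := by nlinarith [pow_pos he0 2]
    have hr1 : r ≤ 1 / 2 := by nlinarith [pow_pos he0 3]
    have : 0 ≤ 3 / 2 * e * (y + p) := by positivity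
    linarith
  have hR' : R ^ 2 ≤ 3600 * e ^ 8 := by
    have h : R = (1071 / 128 - 8001 / 1024 * e + 855 / 64 * e ^ 2
        - 731025 / 32768 * e ^ 3) * e ^ 4 := by
      rw [hR, hp, hr]
      ring
    have hq : (1071 / 128 - 8001 / 1024 * e + 855 / 64 * e ^ 2
        - 731025 / 32768 * e ^ 3) ^ 2 ≤ 60 ^ 2 := by
      refine sq_le_sq' ?_ ?_ <;> nlinarith [pow_pos he0 2, pow_pos he0 3]
    rw [h, mul_pow, ← pow_mul]
    nlinarith [pow_pos he0 8]
  have hmain : 2 * (y - p) * ((y - 1 / 2) / y + 3 / 2 * e * y - r)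
      = 2 / y * ((y - p) ^ 2 * A - (y - p) * R) := by
    rw [hA, hR]
    field_simp
    ring
  have hb : (y - p) ^ 2 / 4 - R ^ 2 ≤ (y - p) ^ 2 * A - (y - p) * R := by
    nlinarith [sq_nonneg ((y - p) / 2 - R), sq_nonneg (y - p)]
  have h2 : 4 ≤ 2 / y := by
    rw [le_div_iff₀ hy]
    linarith
  have h3 : 2 / y ≤ 8 := by
    rw [div_le_iff₀ hy]
    linarith
  rw [hmain]
  have h4 := mul_le_mul_of_nonneg_left hb (by positivity : 0 ≤ 2 / y)
  nlinarith [sq_nonneg (y - p), sq_nonneg R]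

/-- Third order expansion of the slope in powers of `1 / τ`. -/
lemma slope_expansion {H : ℝ → ℝ} (hH : ∀ τ, 1 / 4 ≤ H τ ∧ H τ ≤ 1 / 2)
    (hd : ∀ τ, 2 ≤ τ → HasDerivAt H ((H τ - 1 / 2) / H τ + 3 * H τ / (2 * τ)) τ) :
    ∃ K : ℝ, ∀ τ, 2 ≤ τ →
      |H τ - (1 / 2 - 3 / 8 * τ⁻¹ + 3 / 4 * τ⁻¹ ^ 2 - 285 / 128 * τ⁻¹ ^ 3)| ≤ K * τ⁻¹ ^ 4 := by
  let ψ : ℝ → ℝ := fun τ => 1 / 2 - 3 / 8 * τ⁻¹ + 3 / 4 * τ⁻¹ ^ 2 - 285 / 128 * τ⁻¹ ^ 3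
  let ψ' : ℝ → ℝ := fun τ => 3 / 8 * τ⁻¹ ^ 2 - 3 / 2 * τ⁻¹ ^ 3 + 855 / 128 * τ⁻¹ ^ 4
  have hψ (τ : ℝ) (hτ : 0 < τ) : HasDerivAt ψ (ψ' τ) τ := by
    have h1 := hasDerivAt_inv hτ.ne'
    refine ((((h1.const_mul (3 / 8)).const_sub (1 / 2)).add ((h1.pow 2).const_mul (3 / 4))).sub
      ((h1.pow 3).const_mul (285 / 128))).congr_deriv ?_
    simp only [ψ']
    push_cast
    field_simp
    ring
  have key (τ : ℝ) (hτ : 10 < τ) : |H τ - ψ τ| ≤ 200 * τ⁻¹ ^ 4 := by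
    have h1 : (H τ - ψ τ) ^ 2 ≤ 28800 * τ⁻¹ ^ 8 := by
      refine le_div_pow_of_deriv_ge (w := fun τ => (H τ - ψ τ) ^ 2) (T := 10) (M := 4)
        (w' := fun τ => 2 * (H τ - ψ τ) * ((H τ - 1 / 2) / H τ + 3 * H τ / (2 * τ) - ψ' τ))
        (by norm_num) (by norm_num) (fun t ht => ?_) (fun t ht => ?_) (fun t ht => ?_) hτ
      · refine (((hd t (by linarith)).sub (hψ t (by linarith))).pow 2).congr_deriv ?_
        push_cast
        simp
      · have he0 : 0 < t⁻¹ := inv_pos.mpr (by linarith)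
        have he1 : t⁻¹ ≤ 1 / 10 := by
          rw [inv_le_comm₀ (by linarith) (by norm_num)]
          linarith
        obtain ⟨hl, hu⟩ := hH t
        have ht0 : 3 * H t / (2 * t) = 3 / 2 * t⁻¹ * H t := by
          field_simp
        rw [ht0]
        simp only [ψ, ψ']
        exact slope_error_ineq he0 he1 hl hu
      · have he0 : 0 < t⁻¹ := inv_pos.mpr (by linarith)
        have he1 : t⁻¹ ≤ 1 / 10 := by
          rw [inv_le_comm₀ (by linarith) (by norm_num)]
          linarith
        obtain ⟨hl, hu⟩ := hH t
        simp only [ψ]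
        generalize t⁻¹ = e at *
        have e2 : e ^ 2 ≤ 1 / 100 := by nlinarith
        have e3 : e ^ 3 ≤ 1 / 1000 := by nlinarith [pow_pos he0 2]
        have := pow_pos he0 2
        have := pow_pos he0 3
        rw [show (4 : ℝ) = 2 ^ 2 by norm_num]
        exact sq_le_sq' (by linarith) (by linarith)
    have he0 : 0 < τ⁻¹ := inv_pos.mpr (by linarith)
    refine abs_le_of_sq_le_sq ?_ (by positivity)
    rw [mul_pow, ← pow_mul]
    nlinarith [pow_pos he0 8]
  refine ⟨20000, fun τ hτ => ?_⟩
  have he0 : 0 < τ⁻¹ := inv_pos.mpr (by linarith)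
  rcases lt_or_ge 10 τ with h | h
  · exact (key τ h).trans (mul_le_mul_of_nonneg_right (by norm_num) (by positivity))
  · have he1 : 1 / 10 ≤ τ⁻¹ := by
      rw [one_div]
      exact inv_anti₀ (by linarith) h
    have he2 : τ⁻¹ ≤ 1 / 2 := by
      rw [one_div]
      exact inv_anti₀ (by norm_num) hτ
    have h4 : (1 / 10) ^ 4 ≤ τ⁻¹ ^ 4 := pow_le_pow_left₀ (by norm_num) he1 4
    have h5 : |H τ - ψ τ| ≤ 2 := by
      obtain ⟨hl, hu⟩ := hH τ
      simp only [ψ]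
      generalize τ⁻¹ = e at *
      have e2 : e ^ 2 ≤ 1 / 4 := by nlinarith
      have e3 : e ^ 3 ≤ 1 / 8 := by nlinarith [pow_pos he0 2]
      have := pow_pos he0 2
      have := pow_pos he0 3
      rw [abs_le]
      constructor <;> linarith
    refine h5.trans ?_
    linarith

/-- Scalar autonomous equations with slope in a compact subset of `(0, ∞)` are globally solvable. -/
lemma exists_autonomous_solution_s9 {F : ℝ → ℝ} (hF : Continuous F)
    (hb : ∀ y, 1 / 4 ≤ F y ∧ F y ≤ 1 / 2) (z₀ : ℝ) :
    ∃ z : ℝ → ℝ, z 0 = z₀ ∧ ∀ x, HasDerivAt z (F (z x)) x := by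
  have hpos (y : ℝ) : 0 < F y := by linarith [(hb y).1]
  have hcont : Continuous fun y => (F y)⁻¹ := hF.inv₀ fun y => (hpos y).ne'
  let Φ : ℝ → ℝ := fun y => ∫ t in z₀..y, (F t)⁻¹
  have hΦ (y : ℝ) : HasDerivAt Φ (F y)⁻¹ y := (hcont.integral_hasStrictDerivAt z₀ y).hasDerivAt
  have hstrict : StrictMono Φ := strictMono_of_hasDerivAt_pos hΦ fun y => inv_pos.mpr (hpos y)
  have hmono : Monotone fun y => Φ y - y := by
    refine monotone_of_hasDerivAt_nonneg (fun y => (hΦ y).sub (hasDerivAt_id y)) fun y => ?_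
    have : 1 ≤ (F y)⁻¹ := (one_le_inv₀ (hpos y)).mpr (by linarith [(hb y).2])
    simpa using this
  have hsurj : Function.Surjective Φ := by
    refine (continuous_iff_continuousAt.mpr fun y => (hΦ y).continuousAt).surjective ?_ ?_
    · refine tendsto_atTop_mono' atTop (f₁ := fun y => Φ 0 + y) ?_
        (tendsto_atTop_add_const_left _ _ tendsto_id)
      filter_upwards [eventually_ge_atTop 0] with y hy
      have := hmono hy
      simp only at this
      linarith
    · refine tendsto_atBot_mono' atBot (f₁ := fun y => Φ 0 + y) ?_
        (tendsto_atBot_add_const_left _ _ tendsto_id)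
      filter_upwards [eventually_le_atBot 0] with y hy
      have := hmono hy
      simp only at this
      linarith
  let e := hstrict.orderIsoOfSurjective Φ hsurj
  have he (x : ℝ) : Φ (e.symm x) = x := e.apply_symm_apply x
  refine ⟨e.symm, ?_, fun x => ?_⟩
  · apply hstrict.injective
    rw [he]
    simp [Φ]
  · simpa using HasDerivAt.of_local_left_inverse e.symm.continuous.continuousAt
      (hΦ (e.symm x)) (inv_ne_zero (hpos _).ne') (Eventually.of_forall he)

/-- Cancellations in the third and fourth derivatives of `-1 / (2 z²)`, with `u = 1 / z²` and
`h = z' - 1/2`. -/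
lemma expansion_bounds (K : ℝ) : ∃ C : ℝ, 0 < C ∧ ∀ u h : ℝ, 0 < u → u ≤ 1 / 4 →
    |h - (-3 / 4 * u + 3 * u ^ 2 - 285 / 16 * u ^ 3)| ≤ K * u ^ 4 →
    |h + u * (3 / 4 + 2 * h + h ^ 2)| ≤ u ^ 2 * (3 / 2 + C * u) ∧
    |(h + 3 * (1 / 2 + h) ^ 2 * u) * (1 + (2 + 2 * h) * u) - h * (1 / 2 + h) * u
      - 3 * (3 / 4 + 2 * h + h ^ 2) * (1 / 2 + h) * u ^ 2| ≤ u ^ 3 * (15 / 4 + C * u) := by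
  let h3 : ℝ × ℝ → ℝ := fun p => -285 / 16 + p.1 * p.2
  let h2 : ℝ × ℝ → ℝ := fun p => 3 + p.1 * h3 p
  let h1 : ℝ × ℝ → ℝ := fun p => -3 / 4 + p.1 * h2 p
  let P1 : ℝ × ℝ → ℝ := fun p => h3 p + 3 * h2 p + 3 * h1 p ^ 2
  let Q : ℝ × ℝ → ℝ := fun p => h3 p + 2 * h2 p + h1 p ^ 2
  let S : ℝ × ℝ → ℝ := fun p => p.2 + 3 * h3 p - 9 / 2 * h2 p + 3 * p.1 * h2 p ^ 2 - h3 p / 2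
    + 2 * P1 p + 2 * h1 p * (3 / 4 + p.1 * P1 p) + 3 / 2 * h2 p - p.1 * h2 p ^ 2
    - 21 / 4 * h2 p - 15 / 2 * h1 p ^ 2 - 3 * p.1 * h1 p ^ 3
  have hcomp : IsCompact (Icc (0 : ℝ) (1 / 4) ×ˢ Icc (-K) K) := isCompact_Icc.prod isCompact_Icc
  obtain ⟨C1, hC1⟩ := hcomp.exists_bound_of_continuousOn (f := Q)
    (by fun_prop : Continuous Q).continuousOn
  obtain ⟨C2, hC2⟩ := hcomp.exists_bound_of_continuousOn (f := S)
    (by fun_prop : Continuous S).continuousOn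
  refine ⟨max 1 (max C1 C2), by positivity, fun u h hu hu4 hh => ?_⟩
  obtain ⟨κ, hκ⟩ : ∃ κ, h = -3 / 4 * u + 3 * u ^ 2 - 285 / 16 * u ^ 3 + κ * u ^ 4 :=
    ⟨(h - (-3 / 4 * u + 3 * u ^ 2 - 285 / 16 * u ^ 3)) / u ^ 4, by field_simp; ring⟩
  have hκK : |κ| ≤ K := by
    rw [hκ, add_sub_cancel_left, abs_mul, abs_of_pos (pow_pos hu 4)] at hh
    exact le_of_mul_le_mul_right hh (pow_pos hu 4)
  have hmem : (u, κ) ∈ Icc (0 : ℝ) (1 / 4) ×ˢ Icc (-K) K := ⟨⟨hu.le, hu4⟩, abs_le.mp hκK⟩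
  have hQ : |Q (u, κ)| ≤ max 1 (max C1 C2) :=
    (hC1 _ hmem).trans ((le_max_left _ _).trans (le_max_right _ _))
  have hS : |S (u, κ)| ≤ max 1 (max C1 C2) :=
    (hC2 _ hmem).trans ((le_max_right _ _).trans (le_max_right _ _))
  generalize max 1 (max C1 C2) = C at *
  rw [abs_le] at hQ hS
  constructor
  · have : h + u * (3 / 4 + 2 * h + h ^ 2) = u ^ 2 * (3 / 2 + u * Q (u, κ)) := by
      simp only [Q, h1, h2, h3]
      rw [hκ]
      ring
    rw [this, abs_mul, abs_of_pos (pow_pos hu 2)]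
    refine mul_le_mul_of_nonneg_left ?_ (by positivity)
    have hl := mul_le_mul_of_nonneg_left hQ.1 hu.le
    have hr := mul_le_mul_of_nonneg_left hQ.2 hu.le
    rw [abs_le]
    constructor <;> linarith
  · have : (h + 3 * (1 / 2 + h) ^ 2 * u) * (1 + (2 + 2 * h) * u) - h * (1 / 2 + h) * u
        - 3 * (3 / 4 + 2 * h + h ^ 2) * (1 / 2 + h) * u ^ 2
        = u ^ 3 * (-15 / 4 + u * S (u, κ)) := by
      simp only [S, P1, h1, h2, h3]
      rw [hκ]
      ring
    rw [this, abs_mul, abs_of_pos (pow_pos hu 3)]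
    refine mul_le_mul_of_nonneg_left ?_ (by positivity)
    have hl := mul_le_mul_of_nonneg_left hS.1 hu.le
    have hr := mul_le_mul_of_nonneg_left hS.2 hu.le
    rw [abs_le]
    constructor <;> linarith

lemma hasDerivAt_deriv_of_forall_gt {f f₁ f₂ : ℝ → ℝ}
    (hf : ∀ x, 0 < x → deriv f x = f₁ x) (hf₁ : ∀ x, 0 < x → HasDerivAt f₁ (f₂ x) x)
    {x : ℝ} (hx : 0 < x) : HasDerivAt (deriv f) (f₂ x) x := by
  refine (hf₁ x hx).congr_of_eventuallyEq ?_
  filter_upwards [Ioi_mem_nhds hx] with y hy using hf y hy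

/-- The stationary profile: `q = -1 / (2 z²)` where `z' = 1/2 + h` and `h` decays like `1 / z²`. -/
lemma exists_profile : ∃ K : ℝ, ∀ z₀ : ℝ, 2 < z₀ → ∃ z h : ℝ → ℝ, z 0 = z₀ ∧
    (∀ x, HasDerivAt z (1 / 2 + h x) x) ∧
    (∀ x, 0 < x → z₀ + x / 4 ≤ z x) ∧
    (∀ x, 0 < x → HasDerivAt h (z x * h x + 3 * (1 / 2 + h x) ^ 2 / z x) x) ∧
    ∀ x, 0 < x → |h x - (-3 / 4 * ((z x)⁻¹ ^ 2) + 3 * ((z x)⁻¹ ^ 2) ^ 2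
      - 285 / 16 * ((z x)⁻¹ ^ 2) ^ 3)| ≤ K * ((z x)⁻¹ ^ 2) ^ 4 := by
  obtain ⟨H, hH, hHc, hHd⟩ := exists_slope
  obtain ⟨K, hK⟩ := slope_expansion hH hHd
  refine ⟨16 * K, fun z₀ hz₀ => ?_⟩
  obtain ⟨z, hz0, hz⟩ := exists_autonomous_solution_s9 (F := fun y => H (y ^ 2 / 2))
    (by fun_prop) (fun y => hH _) z₀
  have hmono : Monotone fun x => z x - 1 / 4 * x := by
    refine monotone_of_hasDerivAt_nonneg
      (fun x => (hz x).sub ((hasDerivAt_id x).const_mul (1 / 4))) fun x => ?_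
    have := (hH (z x ^ 2 / 2)).1
    simp only [Pi.zero_apply]
    linarith
  have hlow (x : ℝ) (hx : 0 < x) : z₀ + x / 4 ≤ z x := by
    have := hmono hx.le
    simp only [hz0] at this
    linarith
  have htau (x : ℝ) (hx : 0 < x) : 2 ≤ z x ^ 2 / 2 := by
    have := hlow x hx
    nlinarith
  refine ⟨z, fun x => H (z x ^ 2 / 2) - 1 / 2, hz0, fun x => ?_, hlow,
    fun x hx => ?_, fun x hx => ?_⟩
  · simpa using hz x
  · have hzx : 0 < z x := by linarith [hlow x hx]
    have hHx : 0 < H (z x ^ 2 / 2) := by linarith [(hH (z x ^ 2 / 2)).1]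
    have h1 : HasDerivAt (fun x => z x ^ 2 / 2) (z x * H (z x ^ 2 / 2)) x := by
      refine (((hz x).pow 2).div_const 2).congr_deriv ?_
      push_cast
      ring
    refine (((hHd _ (htau x hx)).comp x h1).sub_const (1 / 2)).congr_deriv ?_
    field_simp
    ring
  · have hzx : 0 < z x := by linarith [hlow x hx]
    have h1 := hK _ (htau x hx)
    have h2 : (z x ^ 2 / 2)⁻¹ = 2 * (z x)⁻¹ ^ 2 := by field_simp
    rw [h2] at h1
    convert h1 using 1
    · congr 1
      ring
    · ring

lemma profile_bounds {z Y C Q₃ Q₄ s : ℝ} (hY : 0 < Y) (hYz : Y ≤ z) (hC : 0 < C)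
    (hs : s = Real.sqrt 2 * Y)
    (h3 : |Q₃| ≤ z⁻¹ * ((z⁻¹ ^ 2) ^ 2 * (3 / 2 + C * z⁻¹ ^ 2)))
    (h4 : |Q₄| ≤ (z⁻¹ ^ 2) ^ 3 * (15 / 4 + C * z⁻¹ ^ 2)) :
    |Q₃| ≤ 6 * Real.sqrt 2 / s ^ 5 + 16 * C / s ^ 7 ∧
      |Q₄| ≤ 222 / s ^ 6 + 16 * C / s ^ 8 := by
  have hw : z⁻¹ ≤ Y⁻¹ := inv_anti₀ hY hYz
  have hz0 : 0 < z⁻¹ := inv_pos.mpr (hY.trans_le hYz)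
  have hr0 : 0 < Real.sqrt 2 := by positivity
  have hr2 : Real.sqrt 2 ^ 2 = 2 := Real.sq_sqrt (by norm_num)
  have hr3 : Real.sqrt 2 ≤ 2 := by nlinarith
  have hr4 : Real.sqrt 2 ^ 4 = 4 := by linear_combination (Real.sqrt 2 ^ 2 + 2) * hr2
  have hr6 : Real.sqrt 2 ^ 6 = 8 := by linear_combination Real.sqrt 2 ^ 2 * hr4 + 4 * hr2
  have hr8 : Real.sqrt 2 ^ 8 = 16 := by linear_combination (Real.sqrt 2 ^ 4 + 4) * hr4
  have hr5 : Real.sqrt 2 ^ 5 = 4 * Real.sqrt 2 := by rw [pow_succ, hr4]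
  have hr7 : Real.sqrt 2 ^ 7 = 8 * Real.sqrt 2 := by rw [pow_succ, hr6]
  have p5 := pow_le_pow_left₀ hz0.le hw 5
  have p6 := pow_le_pow_left₀ hz0.le hw 6
  have p7 := pow_le_pow_left₀ hz0.le hw 7
  have p8 := pow_le_pow_left₀ hz0.le hw 8
  have hYi : 0 < Y⁻¹ := inv_pos.mpr hY
  rw [hs]
  simp only [mul_pow, hr5, hr6, hr7, hr8]
  constructor
  · have e1 : 6 * Real.sqrt 2 / (4 * Real.sqrt 2 * Y ^ 5) = 3 / 2 * Y⁻¹ ^ 5 := by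
      field_simp
      norm_num
    have e2 : C * Y⁻¹ ^ 7 ≤ 16 * C / (8 * Real.sqrt 2 * Y ^ 7) := by
      rw [inv_pow, ← div_eq_mul_inv, div_le_div_iff₀ (by positivity) (by positivity)]
      have : 0 < C * Y ^ 7 := by positivity
      nlinarith
    rw [e1]
    have := mul_le_mul_of_nonneg_left p7 hC.le
    calc |Q₃| ≤ 3 / 2 * z⁻¹ ^ 5 + C * z⁻¹ ^ 7 := h3.trans_eq (by ring)
      _ ≤ _ := by linarith
  · have e1 : 222 / (8 * Y ^ 6) = 111 / 4 * Y⁻¹ ^ 6 := by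
      field_simp
      norm_num
    have e2 : 16 * C / (16 * Y ^ 8) = C * Y⁻¹ ^ 8 := by
      field_simp
    rw [e1, e2]
    have := mul_le_mul_of_nonneg_left p8 hC.le
    have : 0 < Y⁻¹ ^ 6 := by positivity
    calc |Q₄| ≤ 15 / 4 * z⁻¹ ^ 6 + C * z⁻¹ ^ 8 := h4.trans_eq (by ring)
      _ ≤ _ := by linarith


/-- Higher-order decay estimates for the stationary solution `q̄` of the
degenerate problem `-q̄'' + q̄ + q̄'/√(-2q̄) = 0` on `(0, ∞)` with `q̄(0⁺) = -s₀`,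
`q̄(+∞) = 0`: bounds on `|q̄'''|` and `|q̄''''|`. -/
theorem stmt_9 :
    ∃ δstar : ℝ, 0 < δstar ∧ δstar ≤ 1/8 ∧
      ∀ s₀ ∈ Set.Ioo 0 δstar,
        ∃ q : ℝ → ℝ, ∃ C : ℝ, 0 < C ∧
          (∀ x ∈ Set.Ioi (0:ℝ),
            DifferentiableAt ℝ q x ∧ DifferentiableAt ℝ (deriv q) x ∧
            DifferentiableAt ℝ (deriv (deriv q)) x ∧
            DifferentiableAt ℝ (deriv (deriv (deriv q))) x) ∧
          (∀ x ∈ Set.Ioi (0:ℝ), -s₀ < q x ∧ q x < 0) ∧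
          (∀ x ∈ Set.Ioi (0:ℝ),
            -(deriv (deriv q) x) + q x + deriv q x / Real.sqrt (-(2 * q x)) = 0) ∧
          Filter.Tendsto q (nhdsWithin 0 (Set.Ioi 0)) (nhds (-s₀)) ∧
          Filter.Tendsto q Filter.atTop (nhds 0) ∧
          (∀ x ∈ Set.Ioi (0:ℝ),
            |deriv (deriv (deriv q)) x| ≤
              6 * Real.sqrt 2 / (1 / Real.sqrt s₀ + x / (2 * Real.sqrt 2)) ^ 5
                + C / (1 / Real.sqrt s₀ + x / (2 * Real.sqrt 2)) ^ 7 ∧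
            |deriv (deriv (deriv (deriv q))) x| ≤
              222 / (1 / Real.sqrt s₀ + x / (2 * Real.sqrt 2)) ^ 6
                + C / (1 / Real.sqrt s₀ + x / (2 * Real.sqrt 2)) ^ 8) := by
  obtain ⟨K, hK⟩ := exists_profile
  obtain ⟨C, hC, hbd⟩ := expansion_bounds K
  refine ⟨1 / 8, by norm_num, le_rfl, fun s₀ hs₀ => ?_⟩
  obtain ⟨hs0, hs8⟩ := hs₀
  obtain ⟨z₀, hz₀⟩ : ∃ z₀, z₀ = 1 / Real.sqrt (2 * s₀) := ⟨_, rfl⟩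
  have hsq : z₀ ^ 2 = 1 / (2 * s₀) := by
    rw [hz₀, div_pow, Real.sq_sqrt (by positivity), one_pow]
  have hz₀pos : 0 < z₀ := by rw [hz₀]; positivity
  have hz₀2 : 2 < z₀ := by
    have : 4 < z₀ ^ 2 := by
      rw [hsq, lt_div_iff₀ (by positivity)]
      linarith
    nlinarith
  have hs₀z : s₀ = 1 / (2 * z₀ ^ 2) := by
    rw [hsq]
    field_simp
  obtain ⟨z, h, hz0, hz, hlow, hh, hexp⟩ := hK z₀ hz₀2
  have hzpos (x : ℝ) (hx : 0 < x) : 0 < z x := by linarith [hlow x hx]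
  let q : ℝ → ℝ := fun x => -(1 / (2 * z x ^ 2))
  let q₁ : ℝ → ℝ := fun x => (1 / 2 + h x) / z x ^ 3
  let q₂ : ℝ → ℝ := fun x => h x / z x ^ 2
  let q₃ : ℝ → ℝ := fun x => h x / z x + (3 / 4 + 2 * h x + h x ^ 2) / z x ^ 3
  let q₄ : ℝ → ℝ := fun x => (z x * h x + 3 * (1 / 2 + h x) ^ 2 / z x) *
    (1 / z x + (2 + 2 * h x) / z x ^ 3) - h x * (1 / 2 + h x) / z x ^ 2
    - 3 * (3 / 4 + 2 * h x + h x ^ 2) * (1 / 2 + h x) / z x ^ 4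
  have d0 (x : ℝ) (hx : z x ≠ 0) : HasDerivAt q (q₁ x) x := by
    refine ((((hz x).pow 2).const_mul 2).inv (by simpa using hx) |>.neg
      |>.congr_of_eventuallyEq (Eventually.of_forall fun y => by simp [q])).congr_deriv ?_
    simp only [q₁, Pi.pow_apply]
    push_cast
    field_simp
  have d1 (x : ℝ) (hx : 0 < x) : HasDerivAt q₁ (q₂ x) x := by
    have hx' := (hzpos x hx).ne'
    refine (((hh x hx).const_add (1 / 2)).div ((hz x).pow 3) (by simpa using hx')).congr_deriv ?_
    simp only [q₂, Pi.pow_apply]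
    push_cast
    field_simp
    ring
  have d2 (x : ℝ) (hx : 0 < x) : HasDerivAt q₂ (q₃ x) x := by
    have hx' := (hzpos x hx).ne'
    refine ((hh x hx).div ((hz x).pow 2) (by simpa using hx')).congr_deriv ?_
    simp only [q₃, Pi.pow_apply]
    push_cast
    field_simp
    ring
  have d3 (x : ℝ) (hx : 0 < x) : HasDerivAt q₃ (q₄ x) x := by
    have hx' := (hzpos x hx).ne'
    refine (((hh x hx).div (hz x) hx').add (((((hh x hx).const_mul 2).const_add (3 / 4)).add
      ((hh x hx).pow 2)).div ((hz x).pow 3) (by simpa using hx'))).congr_deriv ?_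
    simp only [q₄, Pi.pow_apply, Pi.add_apply]
    push_cast
    field_simp
    ring
  have e1 (x : ℝ) (hx : 0 < x) : deriv q x = q₁ x := (d0 x (hzpos x hx).ne').deriv
  have f1 (x : ℝ) (hx : 0 < x) := hasDerivAt_deriv_of_forall_gt e1 d1 hx
  have e2 (x : ℝ) (hx : 0 < x) : deriv (deriv q) x = q₂ x := (f1 x hx).deriv
  have f2 (x : ℝ) (hx : 0 < x) := hasDerivAt_deriv_of_forall_gt e2 d2 hx
  have e3 (x : ℝ) (hx : 0 < x) : deriv (deriv (deriv q)) x = q₃ x := (f2 x hx).deriv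
  have f3 (x : ℝ) (hx : 0 < x) := hasDerivAt_deriv_of_forall_gt e3 d3 hx
  have e4 (x : ℝ) (hx : 0 < x) : deriv (deriv (deriv (deriv q))) x = q₄ x := (f3 x hx).deriv
  refine ⟨q, 16 * C, by positivity, fun x hx => ⟨(d0 x (hzpos x hx).ne').differentiableAt,
    (f1 x hx).differentiableAt, (f2 x hx).differentiableAt, (f3 x hx).differentiableAt⟩,
    fun x hx => ?_, fun x hx => ?_, ?_, ?_, fun x hx => ?_⟩
  · have hx' : 0 < x := hx
    have hzx := hzpos x hx
    have hlt : z₀ < z x := by linarith [hlow x hx]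
    constructor
    · rw [hs₀z]
      simp only [q]
      gcongr
    · simp only [q]
      exact neg_lt_zero.mpr (by positivity)
  · have hzx := hzpos x hx
    have h1 : Real.sqrt (-(2 * q x)) = 1 / z x := by
      have : -(2 * q x) = (1 / z x) ^ 2 := by
        simp only [q]
        field_simp
      rw [this, Real.sqrt_sq (by positivity)]
    rw [e2 x hx, e1 x hx, h1]
    simp only [q, q₁, q₂]
    field_simp
    ring
  · have h1 : Tendsto q (𝓝 0) (𝓝 (q 0)) := (d0 0 (by rw [hz0]; positivity)).continuousAt
    have h2 : q 0 = -s₀ := by simp only [q, hz0, ← hs₀z]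
    rw [h2] at h1
    exact h1.mono_left nhdsWithin_le_nhds
  · have hzt : Tendsto z atTop atTop := by
      refine tendsto_atTop_mono' atTop (f₁ := fun x => z₀ + x / 4) ?_
        (tendsto_atTop_add_const_left _ _ (tendsto_id.atTop_div_const (by norm_num)))
      filter_upwards [eventually_gt_atTop 0] with x hx using hlow x hx
    have h1 : Tendsto (fun x => (2 * z x ^ 2)⁻¹) atTop (𝓝 0) :=
      tendsto_inv_atTop_zero.comp
        (((tendsto_pow_atTop two_ne_zero).comp hzt).const_mul_atTop two_pos)
    simpa [q] using h1.neg
  · have hx' : 0 < x := hx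
    have hzx := hzpos x hx
    have hu : (z x)⁻¹ ^ 2 ≤ 1 / 4 := by
      have : (z x)⁻¹ ≤ 1 / 2 := by
        rw [one_div]
        exact inv_anti₀ two_pos (by linarith [hlow x hx])
      have h0 : 0 < (z x)⁻¹ := inv_pos.mpr hzx
      nlinarith
    obtain ⟨b3, b4⟩ := hbd ((z x)⁻¹ ^ 2) (h x) (by positivity) hu (hexp x hx)
    rw [e4 x hx, e3 x hx]
    refine profile_bounds (z := z x) (Y := z₀ + x / 4) (by positivity) (hlow x hx) hC ?_ ?_ ?_
    · have hr2 : Real.sqrt 2 ^ 2 = 2 := Real.sq_sqrt (by norm_num)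
      rw [hz₀, Real.sqrt_mul (by norm_num)]
      field_simp
      linear_combination (-2 * Real.sqrt s₀ * x) * hr2
    · have h1 : q₃ x = (z x)⁻¹ * (h x + (z x)⁻¹ ^ 2 * (3 / 4 + 2 * h x + h x ^ 2)) := by
        simp only [q₃]
        field_simp
      rw [h1, abs_mul, abs_of_pos (inv_pos.mpr hzx)]
      exact mul_le_mul_of_nonneg_left b3 (inv_pos.mpr hzx).le
    · refine le_of_eq_of_le (congrArg _ ?_) b4
      simp only [q₄]
      field_simp
end
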